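/- arXiv:1906.04371 — 2 statements merged into one kernel-verified Lean document; each statement's English description precedes it below -/
import Mathlib

section
/- Under Assumption A, for every λ ≥ 0 and every u₀ ∈ ℝ, there exists a unique function u ∈ C¹([0,T]) such that u(0) = u₀ and u'(t) + k(t)·D^{α(t)}u(t) = −λ·u(t) for all t ∈ (0,T]. -/
open Real Set Filter

/-- Variable-order Caputo-type fractional derivative: given the order function `α` and the
derivative `g'` of the underlying function, `caputo α g' t = (1/Γ(1-α t)) ∫₀ᵗ g'(s) (t-s)^(-α t) ds`. -/
noncomputable def caputo (α g' : ℝ → ℝ) (t : ℝ) : ℝ :=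
  (1 / Real.Gamma (1 - α t)) * ∫ s in (0:ℝ)..t, g' s * (t - s) ^ (-(α t))

open MeasureTheory Topology in
/-- A weakly singular Volterra operator maps continuous functions to continuous functions. -/
lemma continuousOn_volterra {T : ℝ} {K : ℝ → ℝ → ℝ} {b W : ℝ → ℝ}
    (hb : IntegrableOn b (Ioc 0 T))
    (hKm : ∀ t ∈ Icc 0 T, Measurable (K t))
    (hKc : ∀ r ∈ Ioc 0 T, ContinuousOn (fun t => K t r) (Icc 0 T))
    (hKb : ∀ t ∈ Icc 0 T, ∀ r ∈ Ioc 0 T, |K t r| ≤ b r) (hW : Continuous W) :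
    ContinuousOn (fun t => ∫ r in (0:ℝ)..t, W (t - r) * K t r) (Icc 0 T) := by
  obtain ⟨C, hC⟩ := (isCompact_Icc (a := (0:ℝ)) (b := T)).exists_bound_of_continuousOn
    hW.continuousOn
  have key : ContinuousOn (fun t => ∫ r in Ioc 0 T,
      (Iic t).indicator (fun r => W (t - r) * K t r) r) (Icc 0 T) := by
    intro t₀ ht₀
    refine continuousWithinAt_of_dominated (bound := fun r => C * b r) ?_ ?_ (hb.const_mul C) ?_
    · filter_upwards [self_mem_nhdsWithin] with t ht
      exact (((hW.measurable.comp (measurable_const.sub measurable_id)).mul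
        (hKm t ht)).indicator measurableSet_Iic).aestronglyMeasurable
    · filter_upwards [self_mem_nhdsWithin] with t ht
      filter_upwards [ae_restrict_mem measurableSet_Ioc] with r hr
      have hb0 : 0 ≤ b r := (abs_nonneg _).trans (hKb t ht r hr)
      by_cases hrt : r ≤ t
      · rw [indicator_of_mem (show r ∈ Iic t from hrt), norm_mul]
        have h1 := hC (t - r) ⟨by linarith, by linarith [hr.1, ht.2]⟩
        exact mul_le_mul h1 (hKb t ht r hr) (norm_nonneg _) ((norm_nonneg _).trans h1)
      · rw [indicator_of_notMem (show r ∉ Iic t from hrt), norm_zero]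
        exact mul_nonneg ((norm_nonneg _).trans (hC t ht)) hb0
    · filter_upwards [ae_restrict_mem measurableSet_Ioc,
        ae_restrict_of_ae (Measure.ae_ne volume t₀)] with r hr hne
      rcases lt_or_gt_of_ne hne with h | h
      · have hc : ContinuousWithinAt (fun t => W (t - r) * K t r) (Icc 0 T) t₀ :=
          ((hW.comp (continuous_id.sub continuous_const)).continuousWithinAt).mul
            (hKc r hr t₀ ht₀)
        refine hc.congr_of_eventuallyEq ?_ (indicator_of_mem (show r ∈ Iic t₀ from h.le) _)
        filter_upwards [mem_nhdsWithin_of_mem_nhds (Ioi_mem_nhds h)] with t ht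
        exact indicator_of_mem (show r ∈ Iic t from le_of_lt (mem_Ioi.1 ht)) _
      · refine (continuousWithinAt_const (b := (0:ℝ))).congr_of_eventuallyEq ?_
          (indicator_of_notMem (show r ∉ Iic t₀ from not_le.2 h) _)
        filter_upwards [mem_nhdsWithin_of_mem_nhds (Iio_mem_nhds h)] with t ht
        exact indicator_of_notMem (show r ∉ Iic t from not_le.2 (mem_Iio.1 ht)) _
  refine key.congr fun t ht => ?_
  simp only
  rw [setIntegral_indicator measurableSet_Iic, intervalIntegral.integral_of_le ht.1,
    Ioc_inter_Iic, min_eq_right ht.2]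

open MeasureTheory in
/-- The integrand of a weakly singular Volterra operator is integrable. -/
lemma intervalIntegrable_volterra {T : ℝ} {K : ℝ → ℝ → ℝ} {b W : ℝ → ℝ}
    (hb : IntegrableOn b (Ioc 0 T))
    (hKm : ∀ t ∈ Icc 0 T, Measurable (K t))
    (hKb : ∀ t ∈ Icc 0 T, ∀ r ∈ Ioc 0 T, |K t r| ≤ b r) (hW : Continuous W)
    {t : ℝ} (ht : t ∈ Icc 0 T) :
    IntervalIntegrable (fun r => W (t - r) * K t r) volume 0 t := by
  have hK : IntervalIntegrable (K t) volume 0 t := by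
    rw [intervalIntegrable_iff_integrableOn_Ioc_of_le ht.1]
    refine (hb.mono_set (Ioc_subset_Ioc_right ht.2)).mono' (hKm t ht).aestronglyMeasurable ?_
    filter_upwards [ae_restrict_mem measurableSet_Ioc] with r hr
    exact hKb t ht r (Ioc_subset_Ioc_right ht.2 hr)
  exact hK.continuousOn_mul (hW.comp (continuous_const.sub continuous_id)).continuousOn

open MeasureTheory Topology in
/-- Exponential damping makes the integral of an integrable function small. -/
lemma tendsto_setIntegral_exp_neg_mul {T : ℝ} {b : ℝ → ℝ} (hb : IntegrableOn b (Ioc 0 T)) :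
    Tendsto (fun γ : ℝ => ∫ r in Ioc 0 T, Real.exp (-(γ * r)) * b r) atTop (𝓝 0) := by
  have h := tendsto_integral_filter_of_dominated_convergence (μ := volume.restrict (Ioc 0 T))
    (F := fun (γ : ℝ) r => Real.exp (-(γ * r)) * b r) (f := fun _ => 0) (l := atTop)
    (fun r => ‖b r‖) ?_ ?_ hb.norm ?_
  · simpa using h
  · exact Eventually.of_forall fun γ =>
      (Continuous.aestronglyMeasurable (by fun_prop)).mul hb.aestronglyMeasurable
  · filter_upwards [eventually_ge_atTop 0] with γ hγ
    filter_upwards [ae_restrict_mem measurableSet_Ioc] with r hr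
    rw [norm_mul, Real.norm_of_nonneg (Real.exp_pos _).le]
    refine mul_le_of_le_one_left (norm_nonneg _) (Real.exp_le_one_iff.2 ?_)
    have := mul_nonneg hγ hr.1.le
    linarith
  · filter_upwards [ae_restrict_mem measurableSet_Ioc] with r hr
    have h1 : Tendsto (fun γ : ℝ => Real.exp (-(γ * r))) atTop (𝓝 0) :=
      Real.tendsto_exp_neg_atTop_nhds_zero.comp (tendsto_id.atTop_mul_const hr.1)
    simpa using h1.mul_const (b r)

open MeasureTheory in
/-- A linear Volterra equation of the second kind with weakly singular kernel has exactly one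
continuous solution. -/
theorem existsUnique_volterra {T : ℝ} (hT : 0 ≤ T) {K : ℝ → ℝ → ℝ} {b : ℝ → ℝ}
    (hb : IntegrableOn b (Ioc 0 T))
    (hKm : ∀ t ∈ Icc 0 T, Measurable (K t))
    (hKc : ∀ r ∈ Ioc 0 T, ContinuousOn (fun t => K t r) (Icc 0 T))
    (hKb : ∀ t ∈ Icc 0 T, ∀ r ∈ Ioc 0 T, |K t r| ≤ b r) (f : ℝ) :
    ∃! w : C(Icc 0 T, ℝ), ∀ t : Icc 0 T,
      w t = f + ∫ r in (0:ℝ)..t, IccExtend hT w (t - r) * K t r := by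
  obtain ⟨γ, hγ⟩ := ((tendsto_setIntegral_exp_neg_mul hb).eventually_lt_const
    (show (0:ℝ) < 1 / 2 by norm_num)).exists
  set E : ℝ → C(Icc 0 T, ℝ) := fun c => ⟨fun t => Real.exp (c * t), by fun_prop⟩ with hE
  have hEE : ∀ c y, E (-c) * (E c * y) = y := by
    intro c y
    ext t
    simp only [hE, ContinuousMap.mul_apply, ContinuousMap.coe_mk]
    rw [← mul_assoc, ← Real.exp_add]
    simp
  let A : C(Icc 0 T, ℝ) → C(Icc 0 T, ℝ) := fun w =>
    ⟨fun t => f + ∫ r in (0:ℝ)..t, IccExtend hT w (t - r) * K t r,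
      continuous_const.add (continuousOn_iff_continuous_domRestrict.1
        (continuousOn_volterra hb hKm hKc hKb w.continuous.Icc_extend'))⟩
  let Φ : C(Icc 0 T, ℝ) → C(Icc 0 T, ℝ) := fun y => E (-γ) * A (E γ * y)
  have hΦ : ContractingWith (1 / 2) Φ := by
    refine ⟨by norm_num, LipschitzWith.of_dist_le_mul fun y z => ?_⟩
    rw [ContinuousMap.dist_le (by positivity)]
    rintro ⟨t, ht⟩
    have hi : ∀ w : C(Icc 0 T, ℝ),
        IntervalIntegrable (fun r => IccExtend hT w (t - r) * K t r) volume 0 t := fun w =>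
      intervalIntegrable_volterra hb hKm hKb w.continuous.Icc_extend' ht
    have hdiff : Φ y ⟨t, ht⟩ - Φ z ⟨t, ht⟩ = ∫ r in (0:ℝ)..t, Real.exp (-γ * t) *
        (IccExtend hT (E γ * y) (t - r) * K t r - IccExtend hT (E γ * z) (t - r) * K t r) := by
      rw [intervalIntegral.integral_const_mul, intervalIntegral.integral_sub (hi _) (hi _)]
      simp only [Φ, A, hE, ContinuousMap.mul_apply, ContinuousMap.coe_mk]
      ring
    have hbi : IntegrableOn (fun r => Real.exp (-(γ * r)) * b r) (Ioc 0 T) := by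
      rw [← intervalIntegrable_iff_integrableOn_Ioc_of_le hT] at hb ⊢
      exact hb.continuousOn_mul (by fun_prop)
    have hpt : ∀ r ∈ Ioc 0 t, ‖Real.exp (-γ * t) *
        (IccExtend hT (E γ * y) (t - r) * K t r - IccExtend hT (E γ * z) (t - r) * K t r)‖
        ≤ dist y z * (Real.exp (-(γ * r)) * b r) := by
      intro r hr
      have hmem : t - r ∈ Icc 0 T := ⟨by linarith [hr.2], by linarith [hr.1, ht.2]⟩
      rw [IccExtend_of_mem _ _ hmem, IccExtend_of_mem _ _ hmem]
      have he : Real.exp (-γ * t) * Real.exp (γ * (t - r)) = Real.exp (-(γ * r)) := by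
        rw [← Real.exp_add]; ring_nf
      have heq : Real.exp (-γ * t) * ((E γ * y) ⟨t - r, hmem⟩ * K t r
          - (E γ * z) ⟨t - r, hmem⟩ * K t r)
          = Real.exp (-(γ * r)) * ((y ⟨t - r, hmem⟩ - z ⟨t - r, hmem⟩) * K t r) := by
        rw [← he]
        simp only [hE, ContinuousMap.mul_apply, ContinuousMap.coe_mk]
        ring
      rw [heq, norm_mul, norm_mul, Real.norm_of_nonneg (Real.exp_pos _).le]
      have h1 : ‖y ⟨t - r, hmem⟩ - z ⟨t - r, hmem⟩‖ ≤ dist y z := by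
        rw [← dist_eq_norm]
        exact ContinuousMap.dist_apply_le_dist _
      have h2 := hKb t ht r (Ioc_subset_Ioc_right ht.2 hr)
      calc _ ≤ Real.exp (-(γ * r)) * (dist y z * b r) := by
            gcongr
            exact h2
        _ = _ := by ring
    rw [Real.dist_eq, hdiff]
    calc _ ≤ ∫ r in (0:ℝ)..t, dist y z * (Real.exp (-(γ * r)) * b r) := by
          refine intervalIntegral.norm_integral_le_of_norm_le ht.1
            (Eventually.of_forall hpt) ?_
          rw [intervalIntegrable_iff_integrableOn_Ioc_of_le ht.1]
          exact (hbi.mono_set (Ioc_subset_Ioc_right ht.2)).const_mul _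
      _ ≤ dist y z * ∫ r in Ioc 0 T, Real.exp (-(γ * r)) * b r := by
          rw [intervalIntegral.integral_const_mul, intervalIntegral.integral_of_le ht.1]
          refine mul_le_mul_of_nonneg_left ?_ dist_nonneg
          refine setIntegral_mono_set hbi ?_ (Ioc_subset_Ioc_right ht.2).eventuallyLE
          filter_upwards [ae_restrict_mem measurableSet_Ioc] with r hr
          exact mul_nonneg (Real.exp_pos _).le ((abs_nonneg _).trans (hKb t ht r hr))
      _ ≤ _ := by
          rw [mul_comm]
          push_cast
          exact mul_le_mul_of_nonneg_right hγ.le dist_nonneg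
  have hfix : ∀ w : C(Icc 0 T, ℝ), (∀ t : Icc 0 T, w t = f + ∫ r in (0:ℝ)..t, IccExtend hT w (t - r) * K t r) ↔
      A w = w := fun w => by
    rw [ContinuousMap.ext_iff]
    exact forall_congr' fun t => eq_comm
  simp only [hfix]
  refine ⟨E γ * hΦ.fixedPoint Φ, ?_, fun w hw => ?_⟩
  · have h : E (-γ) * A (E γ * hΦ.fixedPoint Φ) = hΦ.fixedPoint Φ := hΦ.fixedPoint_isFixedPt
    have h' := hEE (-γ) (A (E γ * hΦ.fixedPoint Φ))
    rw [h, neg_neg] at h'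
    exact h'.symm
  · have h : E (-γ) * w = hΦ.fixedPoint Φ := by
      refine hΦ.fixedPoint_unique ?_
      have h1 := hEE (-γ) w
      rw [neg_neg] at h1
      change E (-γ) * A (E γ * (E (-γ) * w)) = _
      rw [h1, hw]
    rw [← h]
    simpa using (hEE (-γ) w).symm

/-- The Caputo derivative depends only on the values of `g'` on `[0,t]`. -/
lemma caputo_congr {α g h : ℝ → ℝ} {t : ℝ} (ht : 0 ≤ t) (hgh : EqOn g h (Icc 0 t)) :
    caputo α g t = caputo α h t := by
  unfold caputo
  congr 1
  refine intervalIntegral.integral_congr fun s hs => ?_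
  rw [uIcc_of_le ht] at hs
  simp only [hgh hs]

/-- The convolution kernel of the Volterra equation satisfied by the derivative of a solution of
the fractional mode equation. -/
noncomputable def modeKernel (α k : ℝ → ℝ) (lam t r : ℝ) : ℝ :=
  -(k t / Real.Gamma (1 - α t) * r ^ (-(α t)) + lam)

lemma integral_modeKernel {α k W : ℝ → ℝ} (hW : Continuous W) (lam : ℝ) {t : ℝ}
    (hα : α t < 1) :
    ∫ r in (0:ℝ)..t, W (t - r) * modeKernel α k lam t r =
      -(k t * caputo α W t) - lam * ∫ s in (0:ℝ)..t, W s := by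
  have h1 := intervalIntegral.integral_comp_sub_left (a := 0) (b := t)
    (fun s => W s * modeKernel α k lam t (t - s)) t
  simp only [sub_sub_cancel, sub_self, sub_zero] at h1
  have hi : IntervalIntegrable (fun s => W s * (t - s) ^ (-(α t))) MeasureTheory.volume 0 t := by
    refine IntervalIntegrable.continuousOn_mul ?_ hW.continuousOn
    have h := (intervalIntegral.intervalIntegrable_rpow' (a := t) (b := 0)
      (show -1 < -(α t) by linarith)).comp_sub_left t
    simpa using h
  have h2 : ∀ s, W s * modeKernel α k lam t (t - s) =
      -(k t / Real.Gamma (1 - α t)) * (W s * (t - s) ^ (-(α t))) - lam * W s := by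
    intro s
    unfold modeKernel
    ring
  rw [h1, intervalIntegral.integral_congr (fun s _ => h2 s), intervalIntegral.integral_sub
    (hi.const_mul _) ((hW.intervalIntegrable _ _).const_mul _),
    intervalIntegral.integral_const_mul, intervalIntegral.integral_const_mul]
  unfold caputo
  ring

lemma measurable_modeKernel (α k : ℝ → ℝ) (lam t : ℝ) : Measurable (modeKernel α k lam t) := by
  unfold modeKernel
  fun_prop

lemma continuousOn_div_Gamma {S : Set ℝ} {α k : ℝ → ℝ} (hα : ContinuousOn α S)
    (hk : ContinuousOn k S) (hα1 : ∀ t ∈ S, α t < 1) :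
    ContinuousOn (fun t => k t / Real.Gamma (1 - α t)) S := by
  refine hk.div (fun t ht => ?_) fun t ht => (Real.Gamma_pos_of_pos (by linarith [hα1 t ht])).ne'
  have hG : ContinuousAt Real.Gamma (1 - α t) :=
    (Real.differentiableAt_Gamma fun m => by
      have := hα1 t ht
      have : (0:ℝ) ≤ m := m.cast_nonneg
      intro h
      linarith).continuousAt
  exact hG.comp_continuousWithinAt (f := fun t => 1 - α t)
    (continuousWithinAt_const.sub (hα t ht))

lemma continuousOn_modeKernel {S : Set ℝ} {α k : ℝ → ℝ} (hα : ContinuousOn α S)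
    (hk : ContinuousOn k S) (hα1 : ∀ t ∈ S, α t < 1) (lam : ℝ) {r : ℝ} (hr : 0 < r) :
    ContinuousOn (fun t => modeKernel α k lam t r) S :=
  (((continuousOn_div_Gamma hα hk hα1).mul
    (continuousOn_const.rpow hα.neg fun _ _ => Or.inl hr.ne')).add continuousOn_const).neg

lemma abs_modeKernel_le {α k : ℝ → ℝ} {lam M a t r : ℝ} (h0 : 0 ≤ α t) (h1 : α t ≤ a)
    (hM : |k t / Real.Gamma (1 - α t)| ≤ M) (hr : 0 < r) :
    |modeKernel α k lam t r| ≤ M * (r ^ (-a) + 1) + |lam| := by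
  have hM0 : 0 ≤ M := (abs_nonneg _).trans hM
  have hpow : r ^ (-(α t)) ≤ r ^ (-a) + 1 := by
    rcases le_total r 1 with h | h
    · have := Real.rpow_le_rpow_of_exponent_ge hr h (neg_le_neg h1)
      linarith
    · have := Real.rpow_le_one_of_one_le_of_nonpos h (neg_nonpos.2 h0)
      have := (Real.rpow_pos_of_pos hr (-a)).le
      linarith
  unfold modeKernel
  rw [abs_neg]
  refine (abs_add_le _ _).trans (add_le_add_left ?_ _)
  rw [abs_mul, abs_of_pos (Real.rpow_pos_of_pos hr _)]
  exact mul_le_mul hM hpow (Real.rpow_pos_of_pos hr _).le hM0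

/-- Under Assumption A, for every `λ ≥ 0` and initial value `u₀`, the fractional mode equation
`u' + k ⬝ D^{α(⬝)} u = -λ u` on `(0,T]` with `u(0) = u₀` has a unique `C¹([0,T])` solution. -/
theorem uniqueness_existence_mode_equation
    (T αstar : ℝ) (α k : ℝ → ℝ) (hT : 0 < T)
    (hαcont : ContinuousOn α (Icc 0 T)) (hkcont : ContinuousOn k (Icc 0 T))
    (hαstar0 : 0 < αstar) (hαstar1 : αstar < 1)
    (hαbdd : ∀ t ∈ Icc 0 T, 0 ≤ α t ∧ α t ≤ αstar)
    (hlim : ∃ ℓ : ℝ, Tendsto (fun t => (α t - α 0) * Real.log t)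
      (nhdsWithin 0 (Ioi 0)) (nhds ℓ))
    (lam u₀ : ℝ) (hlam : 0 ≤ lam) :
    ∃ u : ℝ → ℝ,
      (ContDiffOn ℝ 1 u (Icc 0 T) ∧ u 0 = u₀ ∧
        ∀ t ∈ Ioc 0 T,
          derivWithin u (Icc 0 T) t
            + k t * caputo α (derivWithin u (Icc 0 T)) t = -lam * u t) ∧
      ∀ v : ℝ → ℝ,
        (ContDiffOn ℝ 1 v (Icc 0 T) ∧ v 0 = u₀ ∧
          ∀ t ∈ Ioc 0 T,
            derivWithin v (Icc 0 T) t
              + k t * caputo α (derivWithin v (Icc 0 T)) t = -lam * v t) →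
        EqOn v u (Icc 0 T) := by
  have hα1 : ∀ t ∈ Icc 0 T, α t < 1 := fun t ht => (hαbdd t ht).2.trans_lt hαstar1
  obtain ⟨M, hM⟩ := (isCompact_Icc (a := (0:ℝ)) (b := T)).exists_bound_of_continuousOn
    (continuousOn_div_Gamma hαcont hkcont hα1)
  have hb : MeasureTheory.IntegrableOn
      (fun r : ℝ => M * (r ^ (-αstar) + 1) + |lam|) (Ioc 0 T) := by
    rw [← intervalIntegrable_iff_integrableOn_Ioc_of_le hT.le]
    exact (((intervalIntegral.intervalIntegrable_rpow' (by linarith)).add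
      intervalIntegrable_const).const_mul M).add intervalIntegrable_const
  have hKm : ∀ t ∈ Icc 0 T, Measurable (modeKernel α k lam t) := fun t _ =>
    measurable_modeKernel α k lam t
  have hKc : ∀ r ∈ Ioc 0 T, ContinuousOn (fun t => modeKernel α k lam t r) (Icc 0 T) :=
    fun r hr => continuousOn_modeKernel hαcont hkcont hα1 lam hr.1
  have hKb : ∀ t ∈ Icc 0 T, ∀ r ∈ Ioc 0 T,
      |modeKernel α k lam t r| ≤ M * (r ^ (-αstar) + 1) + |lam| := fun t ht r hr =>
    abs_modeKernel_le (hαbdd t ht).1 (hαbdd t ht).2 (hM t ht) hr.1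
  obtain ⟨w, hw, hw_unique⟩ := existsUnique_volterra hT.le hb hKm hKc hKb (-lam * u₀)
  have hW : Continuous (IccExtend hT.le w) := w.continuous.Icc_extend'
  have hderiv : ∀ t, HasDerivAt (fun t => u₀ + ∫ s in (0:ℝ)..t, IccExtend hT.le w s)
      (IccExtend hT.le w t) t := fun t =>
    ((hW.integral_hasStrictDerivAt 0 t).hasDerivAt).const_add u₀
  have hdw : EqOn (derivWithin (fun t => u₀ + ∫ s in (0:ℝ)..t, IccExtend hT.le w s) (Icc 0 T))
      (IccExtend hT.le w) (Icc 0 T) := fun t ht =>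
    (hderiv t).hasDerivWithinAt.derivWithin (uniqueDiffOn_Icc hT t ht)
  refine ⟨fun t => u₀ + ∫ s in (0:ℝ)..t, IccExtend hT.le w s, ⟨?_, by simp, fun t ht => ?_⟩, ?_⟩
  · refine (contDiff_one_iff_deriv.2 ⟨fun t => (hderiv t).differentiableAt, ?_⟩).contDiffOn
    rwa [funext fun t => (hderiv t).deriv]
  · have htI := Ioc_subset_Icc_self ht
    have h := hw ⟨t, htI⟩
    simp only [integral_modeKernel hW lam (hα1 t htI)] at h
    rw [caputo_congr ht.1.le (hdw.mono (Icc_subset_Icc_right ht.2)), hdw htI,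
      IccExtend_of_mem _ _ htI, h]
    ring
  · rintro v ⟨hv, hv0, hveq⟩
    have hg := hv.continuousOn_derivWithin (uniqueDiffOn_Icc hT) le_rfl
    let y : C(Icc 0 T, ℝ) := ⟨fun t => derivWithin v (Icc 0 T) t, hg.domRestrict⟩
    have hV : Continuous (IccExtend hT.le y) := y.continuous.Icc_extend'
    have hVg : EqOn (derivWithin v (Icc 0 T)) (IccExtend hT.le y) (Icc 0 T) := fun t ht => by
      rw [IccExtend_of_mem _ _ ht]
      rfl
    have hv_int : ∀ t ∈ Icc 0 T, v t = u₀ + ∫ s in (0:ℝ)..t, IccExtend hT.le y s := by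
      intro t ht
      have h := intervalIntegral.integral_eq_sub_of_hasDerivAt_of_le (f := v)
        (f' := IccExtend hT.le y) ht.1 (hv.continuousOn.mono (Icc_subset_Icc_right ht.2))
        (fun s hs => ?_) (hV.intervalIntegrable _ _)
      · rw [h, hv0]
        ring
      · have hsI : s ∈ Icc 0 T := ⟨hs.1.le, hs.2.le.trans ht.2⟩
        rw [← hVg hsI]
        exact ((hv.differentiableOn one_ne_zero s hsI).hasDerivWithinAt).hasDerivAt
          (Icc_mem_nhds hs.1 (hs.2.trans_le ht.2))
    have heq : EqOn (IccExtend hT.le y) (fun t => -lam * u₀ +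
        ∫ r in (0:ℝ)..t, IccExtend hT.le y (t - r) * modeKernel α k lam t r) (Icc 0 T) := by
      have hIoc : EqOn (IccExtend hT.le y) (fun t => -lam * u₀ +
          ∫ r in (0:ℝ)..t, IccExtend hT.le y (t - r) * modeKernel α k lam t r) (Ioc 0 T) := by
        intro t ht
        have htI := Ioc_subset_Icc_self ht
        have h := hveq t ht
        rw [caputo_congr ht.1.le (hVg.mono (Icc_subset_Icc_right ht.2)), hVg htI,
          hv_int t htI] at h
        simp only [integral_modeKernel hV lam (hα1 t htI)]
        linarith
      exact hIoc.of_subset_closure hV.continuousOn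
        (continuousOn_const.add (continuousOn_volterra hb hKm hKc hKb hV))
        Ioc_subset_Icc_self (closure_Ioc hT.ne).ge
    have hyw : y = w := hw_unique y fun t => by
      have h := heq t.2
      rwa [IccExtend_of_mem _ _ t.2] at h
    intro t ht
    rw [hv_int t ht, hyw]
end

section
/- Let n ≥ 2 be an integer. Under Assumption A, suppose in addition that α, k ∈ C^{n−1}([0,T]), that α^{(l)}(0) = 0 for 0 ≤ l ≤ n−2, that lim_{t→0⁺} α^{(n−2)}(t)·ln t exists and is finite, and that γ > 1/2 with ∑_{i=1}^∞ λ_i^{γ+2n} u_{0,i}² < ∞. Let u_i ∈ C¹([0,T]) solve u_i(0) = u_{0,i}, u_i'(t) + k(t)·D^{α(t)}u_i(t) = −λ_i u_i(t) on (0,T]. Then each u_i belongs to C^n([0,T]) and there is a constant Q > 0, independent of the data (u_{0,i}), such that max_{0 ≤ l ≤ n} sup_{t∈[0,T]} ∑_{i=1}^∞ λ_i^γ (u_i^{(l)}(t))² ≤ Q² ∑_{i=1}^∞ λ_i^{γ+2n} u_{0,i}². -/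
open Real Set Filter

/-- `v` is `m` times continuously differentiable on `[0,T]`, its `j`-th derivative being bounded by
`B * Λ ^ j` for all `j ≤ m`. -/
def GradedBound (T Λ : ℝ) : ℕ → ℝ → (ℝ → ℝ) → Prop
  | 0, B, v => ContinuousOn v (Icc 0 T) ∧ ∀ t ∈ Icc 0 T, |v t| ≤ B
  | m + 1, B, v => (∀ t ∈ Icc 0 T, |v t| ≤ B) ∧
      ∃ v', (∀ t ∈ Icc 0 T, HasDerivWithinAt v (v' t) (Icc 0 T) t) ∧ GradedBound T Λ m (B * Λ) v'

namespace GradedBound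

variable {T Λ B B' : ℝ} {m : ℕ} {v w : ℝ → ℝ}

theorem abs_le (h : GradedBound T Λ m B v) : ∀ t ∈ Icc 0 T, |v t| ≤ B := by
  cases m with
  | zero => exact h.2
  | succ m => exact h.1

theorem continuousOn (h : GradedBound T Λ m B v) : ContinuousOn v (Icc 0 T) := by
  cases m with
  | zero => exact h.1
  | succ m =>
    obtain ⟨-, v', hv', -⟩ := h
    exact fun t ht => (hv' t ht).continuousWithinAt

theorem mono (hΛ : 0 ≤ Λ) (hB : B ≤ B') (h : GradedBound T Λ m B v) :
    GradedBound T Λ m B' v := by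
  induction m generalizing B B' v with
  | zero => exact ⟨h.1, fun t ht => (h.2 t ht).trans hB⟩
  | succ m ih =>
    obtain ⟨h1, v', hv', h2⟩ := h
    exact ⟨fun t ht => (h1 t ht).trans hB, v', hv', ih (by gcongr) h2⟩

theorem congr (h : GradedBound T Λ m B v) (hvw : EqOn w v (Icc 0 T)) :
    GradedBound T Λ m B w := by
  cases m with
  | zero => exact ⟨h.1.congr hvw, fun t ht => by rw [hvw ht]; exact h.2 t ht⟩
  | succ m =>
    obtain ⟨h1, v', hv', h2⟩ := h
    exact ⟨fun t ht => by rw [hvw ht]; exact h1 t ht, v',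
      fun t ht => (hv' t ht).congr (fun x hx => hvw hx) (hvw ht), h2⟩

theorem of_succ (h : GradedBound T Λ (m + 1) B v) : GradedBound T Λ m B v := by
  induction m generalizing B v with
  | zero => exact ⟨h.continuousOn, h.abs_le⟩
  | succ m ih =>
    obtain ⟨h1, v', hv', h2⟩ := h
    exact ⟨h1, v', hv', ih h2⟩

theorem add (h : GradedBound T Λ m B v) (h' : GradedBound T Λ m B' w) :
    GradedBound T Λ m (B + B') (fun t => v t + w t) := by
  induction m generalizing B B' v w with
  | zero =>
    exact ⟨h.1.add h'.1, fun t ht => (abs_add_le _ _).trans (add_le_add (h.2 t ht) (h'.2 t ht))⟩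
  | succ m ih =>
    obtain ⟨h1, v', hv', h2⟩ := h
    obtain ⟨k1, w', hw', k2⟩ := h'
    refine ⟨fun t ht => (abs_add_le _ _).trans (add_le_add (h1 t ht) (k1 t ht)), _,
      fun t ht => (hv' t ht).add (hw' t ht), ?_⟩
    rw [add_mul]
    exact ih h2 k2

theorem const_mul (c : ℝ) (h : GradedBound T Λ m B v) :
    GradedBound T Λ m (|c| * B) (fun t => c * v t) := by
  induction m generalizing B v with
  | zero =>
    refine ⟨continuousOn_const.mul h.1, fun t ht => ?_⟩
    rw [abs_mul]
    exact mul_le_mul_of_nonneg_left (h.2 t ht) (abs_nonneg c)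
  | succ m ih =>
    obtain ⟨h1, v', hv', h2⟩ := h
    refine ⟨fun t ht => ?_, _, fun t ht => (hv' t ht).const_mul c, ?_⟩
    · rw [abs_mul]
      exact mul_le_mul_of_nonneg_left (h1 t ht) (abs_nonneg c)
    · rw [mul_assoc]
      exact ih h2

theorem neg (h : GradedBound T Λ m B v) : GradedBound T Λ m B (fun t => - v t) := by
  simpa using h.const_mul (-1)

theorem sub (h : GradedBound T Λ m B v) (h' : GradedBound T Λ m B' w) :
    GradedBound T Λ m (B + B') (fun t => v t - w t) := by
  simpa only [sub_eq_add_neg] using h.add h'.neg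

theorem contDiffOn_and_abs_iteratedDerivWithin_le (hT : 0 < T) (h : GradedBound T Λ m B v) :
    ContDiffOn ℝ m v (Icc 0 T) ∧
      ∀ l ≤ m, ∀ t ∈ Icc 0 T, |iteratedDerivWithin l v (Icc 0 T) t| ≤ B * Λ ^ l := by
  have hI := uniqueDiffOn_Icc hT
  induction m generalizing B v with
  | zero =>
    refine ⟨by simpa using h.1, fun l hl t ht => ?_⟩
    obtain rfl : l = 0 := by omega
    simpa using h.2 t ht
  | succ m ih =>
    obtain ⟨h1, v', hv', h2⟩ := h
    have hd : EqOn (derivWithin v (Icc 0 T)) v' (Icc 0 T) :=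
      fun t ht => (hv' t ht).derivWithin (hI t ht)
    obtain ⟨c, hc⟩ := ih h2
    constructor
    · push_cast
      refine (contDiffOn_succ_iff_derivWithin hI).2
        ⟨fun t ht => (hv' t ht).differentiableWithinAt, by simp, c.congr hd⟩
    · intro l hl t ht
      cases l with
      | zero => simpa using h1 t ht
      | succ l =>
        rw [iteratedDerivWithin_succ', iteratedDerivWithin_congr hd ht]
        refine (hc l (by omega) t ht).trans_eq ?_
        ring

end GradedBound

theorem exists_abs_le_of_continuousOn {T : ℝ} {v : ℝ → ℝ} (h : ContinuousOn v (Icc 0 T)) :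
    ∃ C, 0 ≤ C ∧ ∀ t ∈ Icc 0 T, |v t| ≤ C := by
  obtain ⟨C, hC⟩ := isCompact_Icc.exists_bound_of_continuousOn h
  exact ⟨max C 0, le_max_right _ _, fun t ht => (hC t ht).trans (le_max_left _ _)⟩

theorem contDiffOn_succ_of_hasDerivWithinAt {T : ℝ} (hT : 0 < T) {m : ℕ} {v v' : ℝ → ℝ}
    (h : ∀ t ∈ Icc 0 T, HasDerivWithinAt v (v' t) (Icc 0 T) t) (h' : ContDiffOn ℝ m v' (Icc 0 T)) :
    ContDiffOn ℝ ((m + 1 : ℕ)) v (Icc 0 T) := by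
  have hI := uniqueDiffOn_Icc hT
  push_cast
  exact (contDiffOn_succ_iff_derivWithin hI).2
    ⟨fun t ht => (h t ht).differentiableWithinAt, by simp,
      h'.congr fun t ht => (h t ht).derivWithin (hI t ht)⟩

theorem exists_hasDerivWithinAt_of_contDiffOn_succ {T : ℝ} (hT : 0 < T) {m : ℕ} {v : ℝ → ℝ}
    (h : ContDiffOn ℝ ((m + 1 : ℕ)) v (Icc 0 T)) :
    (∀ t ∈ Icc 0 T, HasDerivWithinAt v (derivWithin v (Icc 0 T) t) (Icc 0 T) t) ∧
      ContDiffOn ℝ m (derivWithin v (Icc 0 T)) (Icc 0 T) := by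
  push_cast at h
  obtain ⟨h1, -, h2⟩ := (contDiffOn_succ_iff_derivWithin (uniqueDiffOn_Icc hT)).1 h
  exact ⟨fun t ht => (h1 t ht).hasDerivWithinAt, h2⟩

theorem exists_gradedBound_of_contDiffOn {T : ℝ} (hT : 0 < T) {m : ℕ} {v : ℝ → ℝ}
    (h : ContDiffOn ℝ m v (Icc 0 T)) :
    ∃ C, 0 ≤ C ∧ ∀ Λ, 1 ≤ Λ → GradedBound T Λ m C v := by
  induction m generalizing v with
  | zero =>
    obtain ⟨C, hC, hv⟩ := exists_abs_le_of_continuousOn h.continuousOn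
    exact ⟨C, hC, fun Λ _ => ⟨h.continuousOn, hv⟩⟩
  | succ m ih =>
    obtain ⟨C, hC, hv⟩ := exists_abs_le_of_continuousOn h.continuousOn
    obtain ⟨h1, h2⟩ := exists_hasDerivWithinAt_of_contDiffOn_succ hT h
    obtain ⟨D, hD, hb⟩ := ih h2
    refine ⟨C + D, by positivity, fun Λ hΛ => ⟨fun t ht => (hv t ht).trans (by linarith), _, h1,
      (hb Λ hΛ).mono (by linarith) ?_⟩⟩
    nlinarith

/-- Symbols on `(0,T]`: functions `h`, `q` times differentiable on `(0,T]`, with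
`h^{(l)}(t) = O(t^{s-l-ε})` for all `ε > 0` and `l ≤ q`. -/
def SymbolClass (T : ℝ) : ℕ → ℝ → (ℝ → ℝ) → Prop
  | 0, s, h => ContinuousOn h (Ioc 0 T) ∧ ∀ ε > 0, ∃ C, 0 ≤ C ∧ ∀ t ∈ Ioc 0 T, |h t| ≤ C * t ^ (s - ε)
  | q + 1, s, h => (∀ ε > 0, ∃ C, 0 ≤ C ∧ ∀ t ∈ Ioc 0 T, |h t| ≤ C * t ^ (s - ε)) ∧
      ∃ h', (∀ t ∈ Ioc 0 T, HasDerivWithinAt h (h' t) (Icc 0 T) t) ∧ SymbolClass T q (s - 1) h'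

namespace SymbolClass

variable {T s s' : ℝ} {q : ℕ} {g h : ℝ → ℝ}

theorem bound (H : SymbolClass T q s h) :
    ∀ ε > 0, ∃ C, 0 ≤ C ∧ ∀ t ∈ Ioc 0 T, |h t| ≤ C * t ^ (s - ε) := by
  cases q with
  | zero => exact H.2
  | succ q => exact H.1

theorem continuousOn (H : SymbolClass T q s h) : ContinuousOn h (Ioc 0 T) := by
  cases q with
  | zero => exact H.1
  | succ q =>
    obtain ⟨-, h', hh', -⟩ := H
    exact fun t ht => (hh' t ht).continuousWithinAt.mono Ioc_subset_Icc_self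

theorem of_succ (H : SymbolClass T (q + 1) s h) : SymbolClass T q s h := by
  induction q generalizing s h with
  | zero => exact ⟨H.continuousOn, H.bound⟩
  | succ q ih =>
    obtain ⟨h1, h', hh', h2⟩ := H
    exact ⟨h1, h', hh', ih h2⟩

theorem of_le {q' : ℕ} (hq : q' ≤ q) (H : SymbolClass T q s h) : SymbolClass T q' s h := by
  induction q, hq using Nat.le_induction with
  | base => exact H
  | succ q _ ih => exact ih H.of_succ

theorem bound_mono (hs : s' ≤ s)
    (H : ∀ ε > 0, ∃ C, 0 ≤ C ∧ ∀ t ∈ Ioc 0 T, |h t| ≤ C * t ^ (s - ε)) :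
    ∀ ε > 0, ∃ C, 0 ≤ C ∧ ∀ t ∈ Ioc 0 T, |h t| ≤ C * t ^ (s' - ε) := by
  intro ε hε
  obtain ⟨C, hC, hb⟩ := H ε hε
  rcases le_or_gt T 0 with hT | hT
  · exact ⟨0, le_rfl, fun t ht => absurd (ht.1.trans_le ht.2) (not_lt.2 hT)⟩
  refine ⟨C * T ^ (s - s'), by positivity, fun t ht => (hb t ht).trans ?_⟩
  have : t ^ (s - ε) = t ^ (s - s') * t ^ (s' - ε) := by
    rw [← Real.rpow_add ht.1]; ring_nf
  rw [this, mul_assoc]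
  have h1 : t ^ (s - s') ≤ T ^ (s - s') :=
    Real.rpow_le_rpow ht.1.le ht.2 (by linarith)
  have h2 : 0 ≤ t ^ (s' - ε) := Real.rpow_nonneg ht.1.le _
  gcongr

theorem mono (hs : s' ≤ s) (H : SymbolClass T q s h) : SymbolClass T q s' h := by
  induction q generalizing s s' h with
  | zero => exact ⟨H.1, bound_mono hs H.2⟩
  | succ q ih =>
    obtain ⟨h1, h', hh', h2⟩ := H
    exact ⟨bound_mono hs h1, h', hh', ih (by linarith) h2⟩

theorem congr (H : SymbolClass T q s h) (hgh : EqOn g h (Ioc 0 T)) : SymbolClass T q s g := by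
  have hb : ∀ ε > 0, ∃ C, 0 ≤ C ∧ ∀ t ∈ Ioc 0 T, |g t| ≤ C * t ^ (s - ε) := fun ε hε => by
    obtain ⟨C, hC, hb⟩ := H.bound ε hε
    exact ⟨C, hC, fun t ht => by rw [hgh ht]; exact hb t ht⟩
  cases q with
  | zero => exact ⟨H.1.congr hgh, hb⟩
  | succ q =>
    obtain ⟨h1, h', hh', h2⟩ := H
    refine ⟨hb, h', fun t ht => (hh' t ht).congr_of_eventuallyEq ?_ (hgh ht), h2⟩
    filter_upwards [self_mem_nhdsWithin, mem_nhdsWithin_of_mem_nhds (Ioi_mem_nhds ht.1)] with x hx hx'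
    exact hgh ⟨hx', hx.2⟩

theorem add (H : SymbolClass T q s g) (H' : SymbolClass T q s h) :
    SymbolClass T q s (fun t => g t + h t) := by
  have key : ∀ {s : ℝ} {q : ℕ} {g h : ℝ → ℝ}, SymbolClass T q s g → SymbolClass T q s h →
      ∀ ε > 0, ∃ C, 0 ≤ C ∧ ∀ t ∈ Ioc 0 T, |g t + h t| ≤ C * t ^ (s - ε) := by
    intro s q g h H H' ε hε
    obtain ⟨C, hC, hb⟩ := H.bound ε hε
    obtain ⟨D, hD, hc⟩ := H'.bound ε hε
    refine ⟨C + D, by positivity, fun t ht => (abs_add_le _ _).trans ?_⟩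
    rw [add_mul]
    exact add_le_add (hb t ht) (hc t ht)
  induction q generalizing s g h with
  | zero => exact ⟨H.1.add H'.1, key H H'⟩
  | succ q ih =>
    refine ⟨key H H', ?_⟩
    obtain ⟨-, g', hg', h2⟩ := H
    obtain ⟨-, h', hh', k2⟩ := H'
    exact ⟨_, fun t ht => (hg' t ht).add (hh' t ht), ih h2 k2⟩

theorem mul (H : SymbolClass T q s g) (H' : SymbolClass T q s' h) :
    SymbolClass T q (s + s') (fun t => g t * h t) := by
  have key : ∀ {s s' : ℝ} {q : ℕ} {g h : ℝ → ℝ}, SymbolClass T q s g → SymbolClass T q s' h →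
      ∀ ε > 0, ∃ C, 0 ≤ C ∧ ∀ t ∈ Ioc 0 T, |g t * h t| ≤ C * t ^ (s + s' - ε) := by
    intro s s' q g h H H' ε hε
    obtain ⟨C, hC, hb⟩ := H.bound (ε / 2) (by positivity)
    obtain ⟨D, hD, hc⟩ := H'.bound (ε / 2) (by positivity)
    refine ⟨C * D, by positivity, fun t ht => ?_⟩
    have : t ^ (s + s' - ε) = t ^ (s - ε / 2) * t ^ (s' - ε / 2) := by
      rw [← Real.rpow_add ht.1]; ring_nf
    rw [abs_mul, this, mul_mul_mul_comm]
    exact mul_le_mul (hb t ht) (hc t ht) (abs_nonneg _) ((abs_nonneg _).trans (hb t ht))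
  induction q generalizing s s' g h with
  | zero => exact ⟨H.1.mul H'.1, key H H'⟩
  | succ q ih =>
    refine ⟨key H H', ?_⟩
    have H0 := H.of_succ
    have H0' := H'.of_succ
    obtain ⟨-, g', hg', h2⟩ := H
    obtain ⟨-, h', hh', k2⟩ := H'
    refine ⟨_, fun t ht => (hg' t ht).mul (hh' t ht), ?_⟩
    have e1 : SymbolClass T q (s + s' - 1) (fun t => g' t * h t) := by
      have := ih h2 H0'
      rwa [sub_add_eq_add_sub] at this
    have e2 : SymbolClass T q (s + s' - 1) (fun t => g t * h' t) := by
      have := ih H0 k2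
      rwa [← add_sub_assoc] at this
    exact e1.add e2

theorem of_contDiffOn (hT : 0 < T) (H : ContDiffOn ℝ q h (Icc 0 T)) : SymbolClass T q 0 h := by
  induction q generalizing h with
  | zero =>
    refine ⟨H.continuousOn.mono Ioc_subset_Icc_self, fun ε hε => ?_⟩
    obtain ⟨C, hC, hb⟩ := exists_abs_le_of_continuousOn H.continuousOn
    refine ⟨C * T ^ ε, by positivity, fun t ht => (hb t (Ioc_subset_Icc_self ht)).trans ?_⟩
    have h1 : 1 ≤ T ^ ε * t ^ (0 - ε) := by
      rw [zero_sub, Real.rpow_neg ht.1.le, ← div_eq_mul_inv,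
        one_le_div (Real.rpow_pos_of_pos ht.1 _)]
      exact Real.rpow_le_rpow ht.1.le ht.2 hε.le
    rw [mul_assoc]
    exact le_mul_of_one_le_right hC h1
  | succ q ih =>
    have h0 := ih (H.of_le (by exact_mod_cast Nat.le_succ q))
    obtain ⟨h1, h2⟩ := exists_hasDerivWithinAt_of_contDiffOn_succ hT H
    exact ⟨h0.bound, _, fun t ht => h1 t (Ioc_subset_Icc_self ht), (ih h2).mono (by linarith)⟩

theorem inv (hT : 0 < T) : SymbolClass T q (-1) (fun t => t⁻¹) := by
  have hb : ∀ ε : ℝ, ε > 0 → ∃ C, 0 ≤ C ∧ ∀ t ∈ Ioc 0 T, |t⁻¹| ≤ C * t ^ (-1 - ε) := by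
    intro ε hε
    refine ⟨T ^ ε, by positivity, fun t ht => ?_⟩
    have h1 : 1 ≤ T ^ ε * t ^ (- ε) := by
      rw [Real.rpow_neg ht.1.le, ← div_eq_mul_inv,
        one_le_div (Real.rpow_pos_of_pos ht.1 _)]
      exact Real.rpow_le_rpow ht.1.le ht.2 hε.le
    rw [abs_of_pos (inv_pos.2 ht.1), show -1 - ε = -ε + -1 by ring, Real.rpow_add ht.1,
      Real.rpow_neg_one, ← mul_assoc]
    exact le_mul_of_one_le_left (inv_pos.2 ht.1).le h1
  induction q with
  | zero => exact ⟨continuousOn_id.inv₀ fun t ht => ht.1.ne', hb⟩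
  | succ q ih =>
    refine ⟨hb, fun t => (-1) * (t⁻¹ * t⁻¹), fun t ht => ?_, ?_⟩
    · refine ((hasDerivAt_inv ht.1.ne').hasDerivWithinAt (s := Icc 0 T)).congr_deriv ?_
      rw [pow_two, mul_inv]
      ring
    · have := (of_contDiffOn (q := q) (h := fun _ => (-1 : ℝ)) hT contDiffOn_const).mul (ih.mul ih)
      convert this using 1
      norm_num

theorem log (hT : 0 < T) : SymbolClass T q 0 Real.log := by
  have hb : ∀ ε : ℝ, ε > 0 → ∃ C, 0 ≤ C ∧ ∀ t ∈ Ioc 0 T, |Real.log t| ≤ C * t ^ (0 - ε) := by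
    intro ε hε
    refine ⟨1 / ε + T * T ^ ε, by positivity, fun t ht => ?_⟩
    rw [zero_sub, Real.rpow_neg ht.1.le, ← div_eq_mul_inv, le_div_iff₀ (Real.rpow_pos_of_pos ht.1 _)]
    rcases le_or_gt t 1 with h1 | h1
    · have := Real.abs_log_mul_self_rpow_lt t ε ht.1 h1 hε
      rw [abs_mul, abs_of_pos (Real.rpow_pos_of_pos ht.1 ε)] at this
      have : 0 ≤ T * T ^ ε := by positivity
      linarith
    · rw [abs_of_nonneg (Real.log_nonneg h1.le)]
      have h2 : Real.log t ≤ T := by linarith [Real.log_le_sub_one_of_pos ht.1, ht.2]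
      have h3 : t ^ ε ≤ T ^ ε := Real.rpow_le_rpow ht.1.le ht.2 hε.le
      have h4 : Real.log t * t ^ ε ≤ T * T ^ ε :=
        mul_le_mul h2 h3 (Real.rpow_nonneg ht.1.le _) hT.le
      have : 0 ≤ 1 / ε := by positivity
      linarith
  cases q with
  | zero => exact ⟨fun t ht => (Real.continuousAt_log ht.1.ne').continuousWithinAt, hb⟩
  | succ q =>
    refine ⟨hb, _, fun t ht => (Real.hasDerivAt_log ht.1.ne').hasDerivWithinAt, ?_⟩
    rw [zero_sub]
    exact inv hT

theorem log_pow (hT : 0 < T) (j : ℕ) : SymbolClass T q 0 (fun t => Real.log t ^ j) := by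
  induction j with
  | zero => simpa using of_contDiffOn (q := q) (h := fun _ => (1 : ℝ)) hT contDiffOn_const
  | succ j ih =>
    have := ih.mul (log hT)
    rw [add_zero] at this
    exact this

theorem derivWithin_icc (hT : 0 < T) (H : SymbolClass T (q + 1) s h) :
    SymbolClass T q (s - 1) (derivWithin h (Icc 0 T)) := by
  obtain ⟨-, h', hh', h2⟩ := H
  exact h2.congr fun t ht => (hh' t ht).derivWithin (uniqueDiffOn_Icc hT t (Ioc_subset_Icc_self ht))

/-- A symbol of order at least `q + 1` extended by zero is of class `C^q` on `[0,T]`. -/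
theorem contDiffOn_of_eqOn (hT : 0 < T) (hs : (q : ℝ) + 1 ≤ s) (H : SymbolClass T q s h)
    (hg : EqOn g h (Ioc 0 T)) (hg0 : g 0 = 0) : ContDiffOn ℝ q g (Icc 0 T) := by
  induction q generalizing s g h with
  | zero =>
    obtain ⟨hc, hb⟩ := H
    obtain ⟨C, hC, hb⟩ := hb (1 / 2) (by norm_num)
    refine contDiffOn_zero.2 fun t ht => ?_
    rcases ht.1.eq_or_lt with rfl | h0
    · rw [ContinuousWithinAt, hg0]
      have hlim : Tendsto (fun t : ℝ => C * t ^ (s - 1 / 2)) (nhdsWithin 0 (Icc 0 T)) (nhds 0) := by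
        have hp : 0 < s - 1 / 2 := by push_cast at hs; linarith
        have : ContinuousAt (fun t : ℝ => C * t ^ (s - 1 / 2)) 0 :=
          continuousAt_const.mul (Real.continuousAt_rpow_const _ _ (Or.inr hp.le))
        have h2 := this.tendsto
        simp only [Real.zero_rpow hp.ne', mul_zero] at h2
        exact h2.mono_left nhdsWithin_le_nhds
      refine squeeze_zero_norm' ?_ hlim
      filter_upwards [self_mem_nhdsWithin] with t ht
      rcases ht.1.eq_or_lt with rfl | h0
      · rw [hg0, norm_zero]; exact mul_nonneg hC (Real.rpow_nonneg le_rfl _)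
      · rw [hg ⟨h0, ht.2⟩]; exact hb t ⟨h0, ht.2⟩
    · have h1 : ContinuousWithinAt g (Ioc 0 T) t := (hc.congr hg) t ⟨h0, ht.2⟩
      refine h1.mono_of_mem_nhdsWithin ?_
      filter_upwards [self_mem_nhdsWithin, mem_nhdsWithin_of_mem_nhds (Ioi_mem_nhds h0)] with x hx hx'
      exact ⟨hx', hx.2⟩
  | succ q ih =>
    have Hg := H.congr hg
    obtain ⟨hb, g', hg', h2⟩ := Hg
    push_cast at hs
    have h3 : ContDiffOn ℝ q (fun t => if t = 0 then 0 else g' t) (Icc 0 T) :=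
      ih (by linarith) h2 (fun t ht => if_neg ht.1.ne') (if_pos rfl)
    refine contDiffOn_succ_of_hasDerivWithinAt hT (fun t ht => ?_) h3
    rcases ht.1.eq_or_lt with rfl | h0
    · rw [if_pos rfl]
      obtain ⟨C, hC, hb⟩ := hb (1 / 2) (by norm_num)
      rw [hasDerivWithinAt_iff_tendsto_slope]
      have hp : 0 < s - 1 / 2 - 1 := by linarith [Nat.cast_nonneg (α := ℝ) q]
      have hlim : Tendsto (fun t : ℝ => C * t ^ (s - 1 / 2 - 1)) (nhdsWithin 0 (Icc 0 T \ {0}))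
          (nhds 0) := by
        have : ContinuousAt (fun t : ℝ => C * t ^ (s - 1 / 2 - 1)) 0 :=
          continuousAt_const.mul (Real.continuousAt_rpow_const _ _ (Or.inr hp.le))
        have h2 := this.tendsto
        simp only [Real.zero_rpow hp.ne', mul_zero] at h2
        exact h2.mono_left nhdsWithin_le_nhds
      refine squeeze_zero_norm' ?_ hlim
      filter_upwards [self_mem_nhdsWithin] with t ht
      have ht0 : 0 < t := lt_of_le_of_ne ht.1.1 (Ne.symm ht.2)
      rw [slope_def_field, hg0, sub_zero, sub_zero, Real.norm_eq_abs, abs_div, abs_of_pos ht0,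
        div_le_iff₀ ht0, mul_assoc, ← Real.rpow_add_one ht0.ne', sub_add_cancel]
      exact hb t ⟨ht0, ht.1.2⟩
    · rw [if_neg h0.ne']
      exact hg' t ⟨h0, ht.2⟩

end SymbolClass

theorem exists_abs_le_pow_of_iteratedDerivWithin_eq_zero {T : ℝ} (hT : 0 < T) {p : ℕ} {a : ℝ → ℝ}
    (ha : ContDiffOn ℝ p a (Icc 0 T)) (h0 : ∀ l < p, iteratedDerivWithin l a (Icc 0 T) 0 = 0) :
    ∃ C, 0 ≤ C ∧ ∀ t ∈ Icc 0 T, |a t| ≤ C * t ^ p := by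
  induction p generalizing a with
  | zero =>
    obtain ⟨C, hC, h⟩ := exists_abs_le_of_continuousOn ha.continuousOn
    exact ⟨C, hC, by simpa using h⟩
  | succ p ih =>
    obtain ⟨h1, h2⟩ := exists_hasDerivWithinAt_of_contDiffOn_succ hT ha
    obtain ⟨C, hC, hb⟩ := ih h2 fun l hl => by
      rw [← iteratedDerivWithin_succ']; exact h0 (l + 1) (by omega)
    refine ⟨C, hC, fun t ht => ?_⟩
    have hsub : Icc 0 t ⊆ Icc 0 T := Icc_subset_Icc_right ht.2
    have := Convex.norm_image_sub_le_of_norm_hasDerivWithin_le (s := Icc 0 t) (C := C * t ^ p)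
      (fun x hx => (h1 x (hsub hx)).mono hsub)
      (fun x hx => (hb x (hsub hx)).trans (by
        have := pow_le_pow_left₀ hx.1 hx.2 p
        gcongr)) (convex_Icc 0 t)
      (left_mem_Icc.2 ht.1) (right_mem_Icc.2 ht.1)
    have h00 : a 0 = 0 := by simpa using h0 0 (by omega)
    rw [h00, sub_zero, sub_zero, Real.norm_eq_abs, Real.norm_eq_abs, abs_of_nonneg ht.1] at this
    rw [pow_succ, ← mul_assoc]
    exact this

theorem symbolClass_of_iteratedDerivWithin_eq_zero {T : ℝ} (hT : 0 < T) {p : ℕ} {a : ℝ → ℝ}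
    (ha : ContDiffOn ℝ p a (Icc 0 T)) (h0 : ∀ l < p, iteratedDerivWithin l a (Icc 0 T) 0 = 0) :
    SymbolClass T p p a := by
  have key : ∀ {p : ℕ} {a : ℝ → ℝ}, ContDiffOn ℝ p a (Icc 0 T) →
      (∀ l < p, iteratedDerivWithin l a (Icc 0 T) 0 = 0) →
      ∀ ε > 0, ∃ C, 0 ≤ C ∧ ∀ t ∈ Ioc 0 T, |a t| ≤ C * t ^ ((p : ℝ) - ε) := by
    intro p a ha h0 ε hε
    obtain ⟨C, hC, hb⟩ := exists_abs_le_pow_of_iteratedDerivWithin_eq_zero hT ha h0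
    refine ⟨C * T ^ ε, by positivity, fun t ht => (hb t (Ioc_subset_Icc_self ht)).trans ?_⟩
    rw [mul_assoc, ← Real.rpow_natCast, show (p : ℝ) = ε + (p - ε) by ring, Real.rpow_add ht.1]
    have h1 : t ^ ε ≤ T ^ ε := Real.rpow_le_rpow ht.1.le ht.2 hε.le
    have h2 : 0 ≤ t ^ ((p : ℝ) - ε) := Real.rpow_nonneg ht.1.le _
    simp only [add_sub_cancel]
    gcongr
  induction p generalizing a with
  | zero => exact ⟨ha.continuousOn.mono Ioc_subset_Icc_self, key ha h0⟩
  | succ p ih =>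
    obtain ⟨h1, h2⟩ := exists_hasDerivWithinAt_of_contDiffOn_succ hT ha
    refine ⟨key ha h0, _, fun t ht => h1 t (Ioc_subset_Icc_self ht), ?_⟩
    push_cast
    rw [add_sub_cancel_right]
    exact ih h2 fun l hl => by rw [← iteratedDerivWithin_succ']; exact h0 (l + 1) (by omega)

theorem hasDerivWithinAt_primitive {T : ℝ} {f : ℝ → ℝ} (hf : ContinuousOn f (Icc 0 T)) {t : ℝ}
    (ht : t ∈ Icc 0 T) :
    HasDerivWithinAt (fun x => ∫ s in (0:ℝ)..x, f s) (f t) (Icc 0 T) t := by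
  have : Fact (t ∈ Icc 0 T) := ⟨ht⟩
  refine intervalIntegral.integral_hasDerivWithinAt_right (t := Icc 0 T) ?_ ?_ (hf t ht)
  · refine ContinuousOn.intervalIntegrable (hf.mono ?_)
    rw [uIcc_of_le ht.1]
    exact Icc_subset_Icc_right ht.2
  · exact hf.stronglyMeasurableAtFilter_nhdsWithin measurableSet_Icc t

/-- The Volterra convolution-type operator with kernel `M`. -/
noncomputable def volterra (M : ℝ → ℝ → ℝ) (v : ℝ → ℝ) (t : ℝ) : ℝ :=
  ∫ r in (0:ℝ)..t, M t r * v (t - r)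

/-- Kernels continuous on `[0,T] × (0,T]` with singularity at most `r ^ (-β)`. -/
structure WeakKernel (T β : ℝ) (M : ℝ → ℝ → ℝ) : Prop where
  continuousOn : ContinuousOn (fun p : ℝ × ℝ => M p.1 p.2) (Icc 0 T ×ˢ Ioc 0 T)
  bound : ∃ C, 0 ≤ C ∧ ∀ t ∈ Icc 0 T, ∀ r ∈ Ioc 0 T, |M t r| ≤ C * r ^ (-β)

namespace WeakKernel

variable {T β : ℝ} {M N : ℝ → ℝ → ℝ} {v w : ℝ → ℝ}

theorem continuousOn_integrand (hM : WeakKernel T β M) (hv : ContinuousOn v (Icc 0 T)) :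
    ContinuousOn (fun p : ℝ × ℝ => M p.1 p.2 * v (p.1 - p.2))
      {p | p.1 ∈ Icc 0 T ∧ p.2 ∈ Ioc 0 T ∧ p.2 ≤ p.1} := by
  refine (hM.continuousOn.mono fun p hp => ⟨hp.1, hp.2.1⟩).mul ?_
  refine hv.comp (f := fun p : ℝ × ℝ => p.1 - p.2) (by fun_prop) fun p hp => ?_
  exact ⟨by linarith [hp.2.2], by linarith [hp.1.2, hp.2.1.1]⟩

theorem intervalIntegrable (hβ : β < 1) (hM : WeakKernel T β M) (hv : ContinuousOn v (Icc 0 T))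
    {t : ℝ} (ht : t ∈ Icc 0 T) :
    IntervalIntegrable (fun r => M t r * v (t - r)) MeasureTheory.volume 0 t := by
  obtain ⟨C, hC, hb⟩ := hM.bound
  obtain ⟨D, hD, hvb⟩ := exists_abs_le_of_continuousOn hv
  have h1 : IntervalIntegrable (fun r : ℝ => C * r ^ (-β) * D) MeasureTheory.volume 0 t :=
    ((intervalIntegral.intervalIntegrable_rpow' (by linarith)).const_mul C).mul_const D
  rw [intervalIntegrable_iff_integrableOn_Ioc_of_le ht.1] at h1 ⊢
  refine h1.mono' ?_ ?_
  · refine ContinuousOn.aestronglyMeasurable ?_ measurableSet_Ioc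
    exact (hM.continuousOn_integrand hv).comp (f := fun r => (t, r)) (by fun_prop)
      fun r hr => ⟨ht, ⟨hr.1, hr.2.trans ht.2⟩, hr.2⟩
  · refine MeasureTheory.ae_restrict_of_forall_mem measurableSet_Ioc fun r hr => ?_
    rw [Real.norm_eq_abs, abs_mul]
    have hr' : r ∈ Ioc 0 T := ⟨hr.1, hr.2.trans ht.2⟩
    exact mul_le_mul (hb t ht r hr') (hvb _ ⟨by linarith [hr.2], by linarith [hr.1, ht.2]⟩)
      (abs_nonneg _) ((abs_nonneg _).trans (hb t ht r hr'))

theorem volterra_eq_setIntegral {t T' : ℝ} (ht : t ∈ Icc 0 T') :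
    volterra M v t =
      ∫ r in Ioc 0 T', (Iio t).indicator (fun r => M t r * v (t - r)) r := by
  rw [volterra, intervalIntegral.integral_of_le ht.1,
    MeasureTheory.setIntegral_indicator measurableSet_Iio, MeasureTheory.integral_Ioc_eq_integral_Ioo]
  congr 2
  ext x
  simp only [mem_Ioo, mem_inter_iff, mem_Ioc, mem_Iio]
  exact ⟨fun h => ⟨⟨h.1, h.2.le.trans ht.2⟩, h.2⟩, fun h => ⟨h.1.1, h.2⟩⟩

theorem volterra_sub (hβ : β < 1) (hM : WeakKernel T β M) (hv : ContinuousOn v (Icc 0 T))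
    (hw : ContinuousOn w (Icc 0 T)) {t : ℝ} (ht : t ∈ Icc 0 T) :
    volterra M (fun s => v s - w s) t = volterra M v t - volterra M w t := by
  simp only [volterra, mul_sub]
  exact intervalIntegral.integral_sub (hM.intervalIntegrable hβ hv ht)
    (hM.intervalIntegrable hβ hw ht)

theorem continuousOn_volterra (hβ : β < 1) (hM : WeakKernel T β M)
    (hv : ContinuousOn v (Icc 0 T)) : ContinuousOn (volterra M v) (Icc 0 T) := by
  obtain ⟨C, hC, hb⟩ := hM.bound
  obtain ⟨D, hD, hvb⟩ := exists_abs_le_of_continuousOn hv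
  intro t₀ ht₀
  have hT : 0 ≤ T := ht₀.1.trans ht₀.2
  have hkey : ContinuousWithinAt (fun t => ∫ r in Ioc 0 T,
      (Iio t).indicator (fun r => M t r * v (t - r)) r) (Icc 0 T) t₀ := by
    refine MeasureTheory.continuousWithinAt_of_dominated (bound := fun r => C * r ^ (-β) * D)
      ?_ ?_ ?_ ?_
    · filter_upwards [self_mem_nhdsWithin] with t ht
      rw [aestronglyMeasurable_indicator_iff measurableSet_Iio,
        MeasureTheory.Measure.restrict_restrict measurableSet_Iio]
      refine ContinuousOn.aestronglyMeasurable ?_ (measurableSet_Iio.inter measurableSet_Ioc)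
      exact (hM.continuousOn_integrand hv).comp (f := fun r => (t, r)) (by fun_prop)
        fun r hr => ⟨ht, hr.2, le_of_lt hr.1⟩
    · filter_upwards [self_mem_nhdsWithin] with t ht
      refine MeasureTheory.ae_restrict_of_forall_mem measurableSet_Ioc fun r hr => ?_
      have h0 : 0 ≤ C * r ^ (-β) := mul_nonneg hC (Real.rpow_nonneg hr.1.le _)
      by_cases hrt : r < t
      · rw [indicator_of_mem (mem_Iio.2 hrt), Real.norm_eq_abs, abs_mul]
        exact mul_le_mul (hb t ht r hr) (hvb _ ⟨by linarith, by linarith [hr.1, ht.2]⟩)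
          (abs_nonneg _) h0
      · rw [indicator_of_notMem (by simpa using hrt), norm_zero]
        positivity
    · have h1 : IntervalIntegrable (fun r : ℝ => C * r ^ (-β) * D) MeasureTheory.volume 0 T :=
        ((intervalIntegral.intervalIntegrable_rpow' (by linarith)).const_mul C).mul_const D
      rwa [intervalIntegrable_iff_integrableOn_Ioc_of_le hT] at h1
    · have hne : ∀ᵐ r ∂(MeasureTheory.volume.restrict (Ioc 0 T)), r ≠ t₀ := by
        refine MeasureTheory.ae_restrict_of_ae ?_
        simp [MeasureTheory.ae_iff]
      filter_upwards [hne, MeasureTheory.ae_restrict_mem measurableSet_Ioc] with r hr hr'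
      rcases lt_or_gt_of_ne hr with h | h
      · have h2 : ContinuousWithinAt (fun t => M t r * v (t - r)) (Icc 0 T ∩ Ioi r) t₀ :=
          (hM.continuousOn_integrand hv).comp (f := fun t => (t, r)) (s := Icc 0 T ∩ Ioi r)
            (by fun_prop) (fun t ht => ⟨ht.1, hr', le_of_lt ht.2⟩) t₀ ⟨ht₀, h⟩
        have h3 : ContinuousWithinAt (fun t => M t r * v (t - r)) (Icc 0 T) t₀ :=
          (continuousWithinAt_inter (Ioi_mem_nhds h)).1 h2
        refine h3.congr_of_eventuallyEq ?_ (indicator_of_mem (mem_Iio.2 h) _)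
        filter_upwards [mem_nhdsWithin_of_mem_nhds (Ioi_mem_nhds h)] with t ht
        exact indicator_of_mem (mem_Iio.2 ht) _
      · refine (continuousWithinAt_const (b := (0:ℝ))).congr_of_eventuallyEq ?_
          (indicator_of_notMem (by simpa using h.le) _)
        filter_upwards [mem_nhdsWithin_of_mem_nhds (Iio_mem_nhds h)] with t ht
        exact indicator_of_notMem (by simpa using (le_of_lt ht)) _
  exact hkey.congr (fun t ht => volterra_eq_setIntegral ht) (volterra_eq_setIntegral ht₀)

/-- Exponentially weighted sup norms make a weakly singular Volterra operator arbitrarily small. -/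
theorem exists_weight (hβ : β < 1) (hM : WeakKernel T β M) {η : ℝ} (hη : 0 < η) :
    ∃ σ₀, 0 ≤ σ₀ ∧ ∀ σ, σ₀ ≤ σ → ∀ (v : ℝ → ℝ) (A : ℝ), 0 ≤ A →
      (∀ s ∈ Icc 0 T, |v s| ≤ A * Real.exp (σ * s)) →
      ∀ t ∈ Icc 0 T, |volterra M v t| ≤ η * A * Real.exp (σ * t) := by
  obtain ⟨C, hC, hb⟩ := hM.bound
  have hlim : Tendsto (fun σ : ℝ => C * ((1 / σ) ^ (1 - β) * Real.Gamma (1 - β))) atTop (nhds 0) := by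
    have h1 : Tendsto (fun σ : ℝ => (1 / σ) ^ (1 - β)) atTop (nhds 0) := by
      have h2 : Tendsto (fun σ : ℝ => 1 / σ) atTop (nhds 0) := by
        simpa using tendsto_inv_atTop_zero (𝕜 := ℝ)
      have h3 := (Real.continuousAt_rpow_const 0 (1 - β) (Or.inr (by linarith))).tendsto.comp h2
      rwa [Real.zero_rpow (by linarith)] at h3
    simpa using (h1.mul_const (Real.Gamma (1 - β))).const_mul C
  obtain ⟨σ₁, hσ₁⟩ := eventually_atTop.1 (hlim.eventually (gt_mem_nhds hη))
  refine ⟨max σ₁ 1, by positivity, fun σ hσ v A hA hv t ht => ?_⟩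
  have hσpos : 0 < σ := by linarith [le_max_right σ₁ 1]
  have hgam := Real.integral_rpow_mul_exp_neg_mul_Ioi (a := 1 - β) (r := σ) (by linarith) hσpos
  rw [show 1 - β - 1 = -β by ring] at hgam
  have hpos : 0 < (1 / σ) ^ (1 - β) * Real.Gamma (1 - β) :=
    mul_pos (by positivity) (Real.Gamma_pos_of_pos (by linarith))
  have hI : MeasureTheory.IntegrableOn (fun r : ℝ => r ^ (-β) * Real.exp (-(σ * r))) (Ioi 0) := by
    by_contra h
    rw [MeasureTheory.integral_undef h] at hgam
    linarith
  have hsub : Ioc 0 t ⊆ Ioi (0:ℝ) := fun x hx => hx.1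
  rw [volterra, intervalIntegral.integral_of_le ht.1, ← Real.norm_eq_abs]
  calc ‖∫ r in Ioc 0 t, M t r * v (t - r)‖
      ≤ ∫ r in Ioc 0 t, C * A * Real.exp (σ * t) * (r ^ (-β) * Real.exp (-(σ * r))) := by
        refine MeasureTheory.norm_integral_le_of_norm_le ((hI.mono_set hsub).const_mul _) ?_
        refine MeasureTheory.ae_restrict_of_forall_mem measurableSet_Ioc fun r hr => ?_
        rw [Real.norm_eq_abs, abs_mul]
        have hr' : r ∈ Ioc 0 T := ⟨hr.1, hr.2.trans ht.2⟩
        refine (mul_le_mul (hb t ht r hr') (hv (t - r) ⟨by linarith [hr.2], by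
          linarith [hr.1, ht.2]⟩) (abs_nonneg _)
          (mul_nonneg hC (Real.rpow_nonneg hr.1.le _))).trans_eq ?_
        rw [show σ * (t - r) = σ * t + -(σ * r) by ring, Real.exp_add]
        ring
    _ = C * A * Real.exp (σ * t) * ∫ r in Ioc 0 t, r ^ (-β) * Real.exp (-(σ * r)) :=
        MeasureTheory.integral_const_mul _ _
    _ ≤ C * A * Real.exp (σ * t) * ((1 / σ) ^ (1 - β) * Real.Gamma (1 - β)) := by
        rw [← hgam]
        refine mul_le_mul_of_nonneg_left ?_ (by positivity)
        refine MeasureTheory.setIntegral_mono_set hI ?_ hsub.eventuallyLE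
        refine MeasureTheory.ae_restrict_of_forall_mem measurableSet_Ioi fun r hr => ?_
        exact mul_nonneg (Real.rpow_nonneg (le_of_lt hr) _) (Real.exp_nonneg _)
    _ = (C * ((1 / σ) ^ (1 - β) * Real.Gamma (1 - β))) * A * Real.exp (σ * t) := by ring
    _ ≤ η * A * Real.exp (σ * t) := by
        have := (hσ₁ σ ((le_max_left _ _).trans hσ)).le
        gcongr

end WeakKernel

theorem exists_weighted_sup {T : ℝ} (hT : 0 < T) {e : ℝ → ℝ} (he : ContinuousOn e (Icc 0 T)) (σ : ℝ) :
    ∃ A, 0 ≤ A ∧ (∀ t ∈ Icc 0 T, |e t| ≤ A * Real.exp (σ * t)) ∧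
      ∃ t ∈ Icc 0 T, |e t| = A * Real.exp (σ * t) := by
  have hc : ContinuousOn (fun t => |e t| * Real.exp (-(σ * t))) (Icc 0 T) :=
    he.abs.mul (by fun_prop)
  obtain ⟨t₀, ht₀, hmax⟩ := isCompact_Icc.exists_isMaxOn (nonempty_Icc.2 hT.le) hc
  have hcancel : ∀ t, |e t| * Real.exp (-(σ * t)) * Real.exp (σ * t) = |e t| := fun t => by
    rw [mul_assoc, ← Real.exp_add, neg_add_cancel, Real.exp_zero, mul_one]
  refine ⟨_, by positivity, fun t ht => ?_, t₀, ht₀, (hcancel t₀).symm⟩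
  rw [← hcancel t]
  exact mul_le_mul_of_nonneg_right (hmax ht) (Real.exp_nonneg _)

namespace WeakKernel

variable {T β : ℝ} {M N : ℝ → ℝ → ℝ} {v v' d : ℝ → ℝ}

/-- Weakly singular Volterra equations of the second kind are solvable. -/
theorem exists_solution (hT : 0 < T) (hβ : β < 1) (hM : WeakKernel T β M) {H : ℝ → ℝ}
    (hH : ContinuousOn H (Icc 0 T)) :
    ∃ x, ContinuousOn x (Icc 0 T) ∧ ∀ t ∈ Icc 0 T, x t + volterra M x t = H t := by
  obtain ⟨σ, -, hσ⟩ := hM.exists_weight hβ (η := 1 / 2) (by norm_num)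
  have hσ := hσ σ le_rfl
  let E : C(Icc 0 T, ℝ) → ℝ → ℝ := fun z t => Real.exp (σ * t) * IccExtend hT.le z t
  have hE : ∀ z, ContinuousOn (E z) (Icc 0 T) := fun z =>
    Continuous.continuousOn ((by fun_prop : Continuous fun t => Real.exp (σ * t)).mul
      z.continuous.Icc_extend')
  have hc : ∀ z, Continuous fun t : Icc 0 T =>
      Real.exp (-(σ * t)) * (H t - volterra M (E z) t) := fun z => by
    refine Continuous.mul (by fun_prop) ?_
    exact continuousOn_iff_continuous_domRestrict.1 (hH.sub (hM.continuousOn_volterra hβ (hE z)))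
  let Ψ : C(Icc 0 T, ℝ) → C(Icc 0 T, ℝ) := fun z => ⟨_, hc z⟩
  have hΨ : ContractingWith (1 / 2) Ψ := by
    refine ⟨by norm_num, LipschitzWith.of_dist_le_mul fun z w => ?_⟩
    rw [ContinuousMap.dist_le (by positivity)]
    intro t
    have hdiff : ∀ s ∈ Icc 0 T, |E z s - E w s| ≤ dist z w * Real.exp (σ * s) := by
      intro s hs
      simp only [E, IccExtend_of_mem hT.le _ hs]
      rw [← mul_sub, abs_mul, abs_of_pos (Real.exp_pos _), mul_comm]
      exact mul_le_mul_of_nonneg_right (ContinuousMap.dist_apply_le_dist (f := z) (g := w) ⟨s, hs⟩)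
        (Real.exp_nonneg _)
    have h1 := hσ _ _ dist_nonneg hdiff t t.2
    rw [hM.volterra_sub hβ (hE z) (hE w) t.2] at h1
    have h2 : Ψ z t - Ψ w t =
        -(Real.exp (-(σ * t)) * (volterra M (E z) t - volterra M (E w) t)) := by
      simp only [Ψ, ContinuousMap.coe_mk]
      ring
    rw [Real.dist_eq, h2, abs_neg, abs_mul, abs_of_pos (Real.exp_pos _)]
    calc Real.exp (-(σ * t)) * |volterra M (E z) t - volterra M (E w) t|
        ≤ Real.exp (-(σ * t)) * (1 / 2 * dist z w * Real.exp (σ * t)) := by gcongr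
      _ = 1 / 2 * dist z w * (Real.exp (-(σ * t)) * Real.exp (σ * t)) := by ring
      _ = 1 / 2 * dist z w := by rw [← Real.exp_add, neg_add_cancel, Real.exp_zero, mul_one]
      _ = _ := by push_cast; rfl
  have hfix := hΨ.fixedPoint_isFixedPt
  set z := ContractingWith.fixedPoint Ψ hΨ
  refine ⟨E z, hE z, fun t ht => ?_⟩
  have h1 : z ⟨t, ht⟩ = Real.exp (-(σ * t)) * (H t - volterra M (E z) t) :=
    (DFunLike.congr_fun hfix (⟨t, ht⟩ : Icc 0 T)).symm
  have h2 : E z t = H t - volterra M (E z) t := by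
    have : E z t = Real.exp (σ * t) * z ⟨t, ht⟩ := by
      simp only [E, IccExtend_of_mem hT.le _ ht]
    rw [this, h1, ← mul_assoc, ← Real.exp_add, add_neg_cancel, Real.exp_zero, one_mul]
  linarith

end WeakKernel

namespace WeakKernel

variable {T β : ℝ} {M N : ℝ → ℝ → ℝ} {v v' d : ℝ → ℝ}

theorem integrable_triangle (hβ : β < 1) (hM : WeakKernel T β M) (hv : ContinuousOn v (Icc 0 T))
    {t : ℝ} (ht : t ∈ Icc 0 T) :
    MeasureTheory.Integrable
      ({p : ℝ × ℝ | p.2 < p.1}.indicator fun p => M p.1 p.2 * v (p.1 - p.2))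
      ((MeasureTheory.volume.restrict (Ioc 0 t)).prod (MeasureTheory.volume.restrict (Ioc 0 t))) := by
  obtain ⟨C, hC, hb⟩ := hM.bound
  obtain ⟨D, hD, hvb⟩ := exists_abs_le_of_continuousOn hv
  have h1 : IntervalIntegrable (fun r : ℝ => C * r ^ (-β) * D) MeasureTheory.volume 0 t :=
    ((intervalIntegral.intervalIntegrable_rpow' (by linarith)).const_mul C).mul_const D
  rw [intervalIntegrable_iff_integrableOn_Ioc_of_le ht.1] at h1
  have hms : MeasurableSet {p : ℝ × ℝ | p.2 < p.1} := measurableSet_lt measurable_snd measurable_fst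
  refine (h1.comp_snd (MeasureTheory.volume.restrict (Ioc 0 t))).mono' ?_ ?_
  · rw [aestronglyMeasurable_indicator_iff hms, MeasureTheory.Measure.prod_restrict,
      MeasureTheory.Measure.restrict_restrict hms]
    refine ContinuousOn.aestronglyMeasurable ?_
      (hms.inter (measurableSet_Ioc.prod measurableSet_Ioc))
    exact (hM.continuousOn_integrand hv).mono fun p hp =>
      ⟨⟨hp.2.1.1.le, hp.2.1.2.trans ht.2⟩, ⟨hp.2.2.1, hp.2.2.2.trans ht.2⟩, le_of_lt hp.1⟩
  · rw [MeasureTheory.Measure.prod_restrict]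
    refine MeasureTheory.ae_restrict_of_forall_mem (measurableSet_Ioc.prod measurableSet_Ioc)
      fun p hp => ?_
    have hp2 : p.2 ∈ Ioc 0 T := ⟨hp.2.1, hp.2.2.trans ht.2⟩
    have hp1 : p.1 ∈ Icc 0 T := ⟨hp.1.1.le, hp.1.2.trans ht.2⟩
    have h0 : 0 ≤ C * p.2 ^ (-β) := mul_nonneg hC (Real.rpow_nonneg hp2.1.le _)
    by_cases hlt : p.2 < p.1
    · rw [indicator_of_mem (show p ∈ {p : ℝ × ℝ | p.2 < p.1} from hlt), Real.norm_eq_abs, abs_mul]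
      exact mul_le_mul (hb _ hp1 _ hp2) (hvb _ ⟨by linarith, by linarith [hp2.1, hp1.2]⟩)
        (abs_nonneg _) h0
    · rw [indicator_of_notMem (show p ∉ {p : ℝ × ℝ | p.2 < p.1} from hlt), norm_zero]
      positivity

theorem integral_triangle_swap (hβ : β < 1) (hM : WeakKernel T β M) (hv : ContinuousOn v (Icc 0 T))
    {t : ℝ} (ht : t ∈ Icc 0 T) :
    ∫ r in (0:ℝ)..t, (∫ τ in r..t, M τ r * v (τ - r)) = ∫ τ in (0:ℝ)..t, volterra M v τ := by
  have hswap := MeasureTheory.integral_integral_swap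
    (f := fun τ r => {p : ℝ × ℝ | p.2 < p.1}.indicator (fun p => M p.1 p.2 * v (p.1 - p.2)) (τ, r))
    (hM.integrable_triangle hβ hv ht)
  rw [intervalIntegral.integral_of_le ht.1, intervalIntegral.integral_of_le ht.1]
  refine Eq.trans ?_ (hswap.symm.trans ?_)
  · refine MeasureTheory.setIntegral_congr_fun measurableSet_Ioc fun r hr => ?_
    have h1 : ∀ τ, {p : ℝ × ℝ | p.2 < p.1}.indicator (fun p => M p.1 p.2 * v (p.1 - p.2)) (τ, r) =
        (Ioi r).indicator (fun τ => M τ r * v (τ - r)) τ := fun τ => by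
      simp [indicator_apply]
    simp only [h1]
    rw [MeasureTheory.setIntegral_indicator measurableSet_Ioi, intervalIntegral.integral_of_le hr.2]
    congr 2
    ext x
    simp only [mem_inter_iff, mem_Ioc, mem_Ioi]
    exact ⟨fun h => ⟨⟨hr.1.trans h.1, h.2⟩, h.1⟩, fun h => ⟨h.2, h.1.2⟩⟩
  · refine MeasureTheory.setIntegral_congr_fun measurableSet_Ioc fun τ hτ => ?_
    have h1 : ∀ r, {p : ℝ × ℝ | p.2 < p.1}.indicator (fun p => M p.1 p.2 * v (p.1 - p.2)) (τ, r) =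
        (Iio τ).indicator (fun r => M τ r * v (τ - r)) r := fun r => by
      simp [indicator_apply]
    simp only [h1]
    exact (volterra_eq_setIntegral ⟨hτ.1.le, hτ.2⟩).symm

/-- Differentiation of a Volterra operator: `d` is the trace of `M` on the diagonal and `N` is the
derivative of `M` in its first variable. -/
theorem hasDerivWithinAt_volterra (hβ : β < 1) (hM : WeakKernel T β M)
    (hN : WeakKernel T β N) (hd : ContinuousOn d (Icc 0 T)) (hdM : ∀ t ∈ Ioc 0 T, d t = M t t)
    (hMN : ∀ r ∈ Ioc 0 T, ∀ t ∈ Icc 0 T, HasDerivWithinAt (fun t => M t r) (N t r) (Icc 0 T) t)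
    (hv : ∀ t ∈ Icc 0 T, HasDerivWithinAt v (v' t) (Icc 0 T) t) (hv' : ContinuousOn v' (Icc 0 T)) :
    ∀ t ∈ Icc 0 T, HasDerivWithinAt (volterra M v)
      (v 0 * d t + volterra M v' t + volterra N v t) (Icc 0 T) t := by
  have hvc : ContinuousOn v (Icc 0 T) := fun t ht => (hv t ht).continuousWithinAt
  have hF1 := hM.continuousOn_volterra hβ hv'
  have hF2 := hN.continuousOn_volterra hβ hvc
  have hΦ : ContinuousOn (fun t => v 0 * d t + volterra M v' t + volterra N v t) (Icc 0 T) :=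
    ((continuousOn_const.mul hd).add hF1).add hF2
  have key : ∀ t ∈ Icc 0 T, volterra M v t =
      ∫ s in (0:ℝ)..t, (v 0 * d s + volterra M v' s + volterra N v s) := by
    intro t ht
    have hsub : uIcc 0 t ⊆ Icc 0 T := by
      rw [uIcc_of_le ht.1]; exact Icc_subset_Icc_right ht.2
    have id : IntervalIntegrable (fun s => v 0 * d s) MeasureTheory.volume 0 t :=
      ((continuousOn_const.mul hd).mono hsub).intervalIntegrable
    have i1 := (hF1.mono hsub).intervalIntegrable (μ := MeasureTheory.volume)
    have i2 := (hF2.mono hsub).intervalIntegrable (μ := MeasureTheory.volume)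
    rw [intervalIntegral.integral_add (id.add i1) i2, intervalIntegral.integral_add id i1,
      ← hM.integral_triangle_swap hβ hv' ht, ← hN.integral_triangle_swap hβ hvc ht]
    have hin : ∀ r ∈ Ioc 0 t, M t r * v (t - r) = v 0 * d r +
        ((∫ τ in r..t, M τ r * v' (τ - r)) + ∫ τ in r..t, N τ r * v (τ - r)) := by
      intro r hr
      have hrT : r ∈ Ioc 0 T := ⟨hr.1, hr.2.trans ht.2⟩
      have hsubr : Icc r t ⊆ Icc 0 T := Icc_subset_Icc hr.1.le ht.2
      have cont : ∀ {M : ℝ → ℝ → ℝ} {v : ℝ → ℝ}, WeakKernel T β M → ContinuousOn v (Icc 0 T) →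
          ContinuousOn (fun τ => M τ r * v (τ - r)) (Icc r t) := fun hM hv =>
        (hM.continuousOn_integrand hv).comp (f := fun τ => (τ, r)) (by fun_prop)
          fun τ hτ => ⟨hsubr hτ, hrT, hτ.1⟩
      have j1 : IntervalIntegrable (fun τ => M τ r * v' (τ - r)) MeasureTheory.volume r t :=
        ContinuousOn.intervalIntegrable_of_Icc hr.2 (cont hM hv')
      have j2 : IntervalIntegrable (fun τ => N τ r * v (τ - r)) MeasureTheory.volume r t :=
        ContinuousOn.intervalIntegrable_of_Icc hr.2 (cont hN hvc)
      rw [← intervalIntegral.integral_add j1 j2,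
        intervalIntegral.integral_eq_sub_of_hasDerivAt_of_le (f := fun τ => M τ r * v (τ - r)) hr.2
          (cont hM hvc) ?_ (j1.add j2), hdM r hrT, sub_self]
      · ring
      · intro τ hτ
        have h1 : HasDerivAt (fun t => M t r) (N τ r) τ :=
          (hMN r hrT τ (hsubr (Ioo_subset_Icc_self hτ))).hasDerivAt
            (Icc_mem_nhds (hr.1.trans hτ.1) (hτ.2.trans_le ht.2))
        have h2 : HasDerivAt v (v' (τ - r)) (τ - r) :=
          (hv (τ - r) ⟨by linarith [hτ.1], by linarith [hr.1, hτ.2, ht.2]⟩).hasDerivAt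
            (Icc_mem_nhds (by linarith [hτ.1]) (by linarith [hr.1, hτ.2, ht.2]))
        have h3 : HasDerivAt (fun τ => v (τ - r)) (v' (τ - r)) τ := h2.comp_sub_const τ r
        exact (h1.mul h3).congr_deriv (by ring)
    have int : ∀ {M : ℝ → ℝ → ℝ} {v : ℝ → ℝ}, WeakKernel T β M → ContinuousOn v (Icc 0 T) →
        IntervalIntegrable (fun r => ∫ τ in r..t, M τ r * v (τ - r)) MeasureTheory.volume 0 t := by
      intro M v hM hv
      have h1 := (hM.integrable_triangle hβ hv ht).integral_prod_right
      rw [intervalIntegrable_iff_integrableOn_Ioc_of_le ht.1]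
      refine MeasureTheory.IntegrableOn.congr_fun h1 (fun r hr => ?_) measurableSet_Ioc
      have h1 : ∀ τ, {p : ℝ × ℝ | p.2 < p.1}.indicator (fun p => M p.1 p.2 * v (p.1 - p.2)) (τ, r) =
          (Ioi r).indicator (fun τ => M τ r * v (τ - r)) τ := fun τ => by
        simp [indicator_apply]
      simp only [h1]
      rw [MeasureTheory.setIntegral_indicator measurableSet_Ioi, intervalIntegral.integral_of_le hr.2]
      congr 2
      ext x
      simp only [mem_inter_iff, mem_Ioc, mem_Ioi]
      exact ⟨fun h => ⟨h.2, h.1.2⟩, fun h => ⟨⟨hr.1.trans h.1, h.2⟩, h.1⟩⟩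
    rw [add_assoc, ← intervalIntegral.integral_add (int hM hv') (int hN hvc),
      ← intervalIntegral.integral_add id ((int hM hv').add (int hN hvc)), volterra,
      intervalIntegral.integral_of_le ht.1, intervalIntegral.integral_of_le ht.1]
    exact MeasureTheory.setIntegral_congr_fun measurableSet_Ioc fun r hr => hin r hr
  intro t ht
  exact (hasDerivWithinAt_primitive hΦ ht).congr key (key t ht)

theorem volterra_zero : volterra M v 0 = 0 := by
  simp [volterra]

/-- Continuous solutions of Volterra equations with differentiable data are differentiable, and the
derivative solves the differentiated equation. -/
theorem exists_hasDerivWithinAt_of_volterra_eq (hT : 0 < T) (hβ : β < 1) (hM : WeakKernel T β M)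
    (hN : WeakKernel T β N) (hd : ContinuousOn d (Icc 0 T)) (hdM : ∀ t ∈ Ioc 0 T, d t = M t t)
    (hMN : ∀ r ∈ Ioc 0 T, ∀ t ∈ Icc 0 T, HasDerivWithinAt (fun t => M t r) (N t r) (Icc 0 T) t)
    {y G G' : ℝ → ℝ} (hy : ContinuousOn y (Icc 0 T))
    (hG : ∀ t ∈ Icc 0 T, HasDerivWithinAt G (G' t) (Icc 0 T) t) (hG' : ContinuousOn G' (Icc 0 T))
    (heq : ∀ t ∈ Icc 0 T, y t + volterra M y t = G t) :
    ∃ y', ContinuousOn y' (Icc 0 T) ∧ (∀ t ∈ Icc 0 T, HasDerivWithinAt y (y' t) (Icc 0 T) t) ∧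
      ∀ t ∈ Icc 0 T, y' t + volterra M y' t = G' t - y 0 * d t - volterra N y t := by
  have hFy := hN.continuousOn_volterra hβ hy
  obtain ⟨x, hx, hxeq⟩ := hM.exists_solution hT hβ (H := fun t => G' t - y 0 * d t - volterra N y t)
    ((hG'.sub (continuousOn_const.mul hd)).sub hFy)
  have h0 : (0:ℝ) ∈ Icc 0 T := left_mem_Icc.2 hT.le
  set z : ℝ → ℝ := fun t => y 0 + ∫ s in (0:ℝ)..t, x s with hz
  have hz0 : z 0 = y 0 := by simp [hz]
  have hzd : ∀ t ∈ Icc 0 T, HasDerivWithinAt z (x t) (Icc 0 T) t := fun t ht =>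
    (hasDerivWithinAt_primitive hx ht).const_add (y 0)
  have hzc : ContinuousOn z (Icc 0 T) := fun t ht => (hzd t ht).continuousWithinAt
  have he : ContinuousOn (fun s => z s - y s) (Icc 0 T) := hzc.sub hy
  have hFe := hN.continuousOn_volterra hβ he
  have hident : ∀ t ∈ Icc 0 T, z t + volterra M z t =
      G t + ∫ s in (0:ℝ)..t, volterra N (fun s => z s - y s) s := by
    have hder : ∀ t ∈ Icc 0 T, HasDerivWithinAt
        (fun t => z t + volterra M z t - (G t + ∫ s in (0:ℝ)..t, volterra N (fun s => z s - y s) s))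
        0 (Icc 0 T) t := by
      intro t ht
      have h1 := ((hzd t ht).add (hM.hasDerivWithinAt_volterra hβ hN hd hdM hMN hzd hx t ht)).sub
        ((hG t ht).add (hasDerivWithinAt_primitive hFe ht))
      refine h1.congr_deriv ?_
      rw [hN.volterra_sub hβ hzc hy ht, hz0]
      linarith [hxeq t ht]
    intro t ht
    have h2 := Convex.norm_image_sub_le_of_norm_hasDerivWithin_le (C := 0) hder
      (fun x _ => by simp) (convex_Icc 0 T) h0 ht
    have h3 := heq 0 h0
    simp only [zero_mul, norm_le_zero_iff, volterra_zero, intervalIntegral.integral_same, hz0,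
      add_zero] at h2 h3
    linarith
  have hzy : ∀ t ∈ Icc 0 T, z t - y t = 0 := by
    obtain ⟨σ₁, hσ₁, hw₁⟩ := hM.exists_weight hβ (η := 1 / 4) (by norm_num)
    obtain ⟨σ₂, hσ₂, hw₂⟩ := hN.exists_weight hβ (η := 1 / (4 * T)) (by positivity)
    set σ := max σ₁ σ₂ with hσ
    have hσ0 : 0 ≤ σ := hσ₁.trans (le_max_left _ _)
    obtain ⟨A, hA, hbd, t₀, ht₀, hatt⟩ := exists_weighted_sup hT he σ
    have b1 := hw₁ σ (le_max_left _ _) _ A hA hbd t₀ ht₀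
    have b2 := hw₂ σ (le_max_right _ _) _ A hA hbd
    have b3 : |∫ s in (0:ℝ)..t₀, volterra N (fun s => z s - y s) s| ≤
        1 / (4 * T) * A * Real.exp (σ * t₀) * |t₀ - 0| := by
      rw [← Real.norm_eq_abs]
      refine intervalIntegral.norm_integral_le_of_norm_le_const fun s hs => ?_
      rw [uIoc_of_le ht₀.1] at hs
      refine (b2 s ⟨hs.1.le, hs.2.trans ht₀.2⟩).trans ?_
      have : σ * s ≤ σ * t₀ := mul_le_mul_of_nonneg_left hs.2 hσ0
      gcongr
    have b4 : 1 / (4 * T) * A * Real.exp (σ * t₀) * |t₀ - 0| ≤ 1 / 4 * A * Real.exp (σ * t₀) := by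
      rw [sub_zero, abs_of_nonneg ht₀.1]
      calc 1 / (4 * T) * A * Real.exp (σ * t₀) * t₀
          ≤ 1 / (4 * T) * A * Real.exp (σ * t₀) * T := by
            have := ht₀.2
            gcongr
        _ = 1 / 4 * A * Real.exp (σ * t₀) := by field_simp
    have e1 := hident t₀ ht₀
    have e2 := heq t₀ ht₀
    have e3 := hM.volterra_sub hβ hzc hy ht₀
    have e4 : z t₀ - y t₀ = (∫ s in (0:ℝ)..t₀, volterra N (fun s => z s - y s) s) -
        volterra M (fun s => z s - y s) t₀ := by linarith
    have e5 : |z t₀ - y t₀| ≤ 1 / 2 * (A * Real.exp (σ * t₀)) := by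
      rw [e4]
      refine (abs_sub _ _).trans ?_
      linarith
    rw [hatt] at e5
    have hexp := Real.exp_pos (σ * t₀)
    have hA0 : A = 0 := by nlinarith
    intro t ht
    have := hbd t ht
    rw [hA0, zero_mul] at this
    exact abs_nonpos_iff.1 this
  have hyz : ∀ t ∈ Icc 0 T, y t = z t := fun t ht => by linarith [hzy t ht]
  exact ⟨x, hx, fun t ht => (hzd t ht).congr hyz (hyz t ht), hxeq⟩

end WeakKernel

/-- Kernels that are `m` times differentiable in their first variable, with all these derivatives
weakly singular and with sufficiently smooth traces on the diagonal. -/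
def SmoothKernel (T β : ℝ) : ℕ → (ℝ → ℝ → ℝ) → Prop
  | 0, M => WeakKernel T β M
  | m + 1, M => WeakKernel T β M ∧
      (∃ d, ContDiffOn ℝ m d (Icc 0 T) ∧ ∀ t ∈ Ioc 0 T, d t = M t t) ∧
      ∃ N, (∀ r ∈ Ioc 0 T, ∀ t ∈ Icc 0 T, HasDerivWithinAt (fun t => M t r) (N t r) (Icc 0 T) t) ∧
        SmoothKernel T β m N

namespace SmoothKernel

variable {T β : ℝ} {M N : ℝ → ℝ → ℝ} {m : ℕ}

theorem weakKernel (h : SmoothKernel T β m M) : WeakKernel T β M := by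
  cases m with
  | zero => exact h
  | succ m => exact h.1

theorem of_succ (h : SmoothKernel T β (m + 1) M) : SmoothKernel T β m M := by
  induction m generalizing M with
  | zero => exact h.1
  | succ m ih =>
    obtain ⟨h1, ⟨d, hd, hdM⟩, N, hMN, hN⟩ := h
    exact ⟨h1, ⟨d, hd.of_le (by exact_mod_cast Nat.le_succ m), hdM⟩, N, hMN, ih hN⟩

theorem exists_gradedBound_volterra (hT : 0 < T) (hβ : β < 1) (h : SmoothKernel T β m M) :
    ∃ C, 0 ≤ C ∧ ∀ (Λ B : ℝ) (v : ℝ → ℝ), 1 ≤ Λ → 0 ≤ B → GradedBound T Λ m B v →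
      GradedBound T Λ m (C * B) (volterra M v) := by
  have sup : ∀ {M : ℝ → ℝ → ℝ}, WeakKernel T β M → ∃ C, 0 ≤ C ∧ ∀ (B : ℝ) (v : ℝ → ℝ), 0 ≤ B →
      (∀ t ∈ Icc 0 T, |v t| ≤ B) → ∀ t ∈ Icc 0 T, |volterra M v t| ≤ C * B := by
    intro M hM
    obtain ⟨σ, hσ, hw⟩ := hM.exists_weight hβ (η := 1) one_pos
    refine ⟨Real.exp (σ * T), Real.exp_nonneg _, fun B v hB hv t ht => ?_⟩
    refine (hw σ le_rfl v B hB (fun s hs => (hv s hs).trans ?_) t ht).trans ?_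
    · exact le_mul_of_one_le_right hB (Real.one_le_exp (mul_nonneg hσ hs.1))
    · rw [one_mul, mul_comm]
      have := mul_le_mul_of_nonneg_left ht.2 hσ
      gcongr
  induction m generalizing M with
  | zero =>
    obtain ⟨C, hC, hb⟩ := sup h
    exact ⟨C, hC, fun Λ B v _ hB hv =>
      ⟨WeakKernel.continuousOn_volterra hβ h hv.1, hb B v hB hv.2⟩⟩
  | succ m ih =>
    have hpred := h.of_succ
    obtain ⟨hM, ⟨d, hd, hdM⟩, N, hMN, hN⟩ := h
    obtain ⟨C₀, hC₀, hb₀⟩ := sup hM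
    obtain ⟨C₁, hC₁, hb₁⟩ := ih hpred
    obtain ⟨C₂, hC₂, hb₂⟩ := ih hN
    obtain ⟨D, hD, hb₃⟩ := exists_gradedBound_of_contDiffOn hT hd
    refine ⟨C₀ + C₁ + C₂ + D, by positivity, fun Λ B v hΛ hB hv => ?_⟩
    have hv0 := hv.of_succ
    obtain ⟨hvb, v', hv', hvm⟩ := hv
    have hΛ0 : 0 ≤ Λ := by linarith
    have hBΛ : B ≤ B * Λ := le_mul_of_one_le_right hB hΛ
    refine ⟨fun t ht => (hb₀ B v hB hvb t ht).trans ?_, _,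
      hM.hasDerivWithinAt_volterra hβ hN.weakKernel hd.continuousOn hdM hMN hv' hvm.continuousOn, ?_⟩
    · gcongr
      linarith
    · refine ((((hb₃ Λ hΛ).const_mul (v 0)).add
        (hb₁ Λ (B * Λ) v' hΛ (by positivity) hvm)).add
        (hb₂ Λ (B * Λ) v hΛ (by positivity) (hv0.mono hΛ0 hBΛ))).mono hΛ0 ?_
      have h1 : |v 0| * D ≤ B * Λ * D :=
        mul_le_mul_of_nonneg_right ((hvb 0 (left_mem_Icc.2 hT.le)).trans hBΛ) hD
      have h2 : 0 ≤ C₀ * (B * Λ) := by positivity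
      nlinarith

end SmoothKernel

/-- Damping estimate for `z' = -lam z + φ` with `|φ| ≤ Φ`. -/
theorem mul_abs_le_of_hasDerivWithinAt {T lam Φ t : ℝ} {z φ : ℝ → ℝ} (hlam : 0 < lam)
    (ht : t ∈ Icc 0 T)
    (hz : ∀ s ∈ Icc 0 T, HasDerivWithinAt z (-lam * z s + φ s) (Icc 0 T) s)
    (hφ : ∀ s ∈ Icc 0 t, |φ s| ≤ Φ) : lam * |z t| ≤ lam * |z 0| + Φ := by
  have hΦ : 0 ≤ Φ := (abs_nonneg _).trans (hφ t ⟨ht.1, le_rfl⟩)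
  have hsub : Icc 0 t ⊆ Icc 0 T := Icc_subset_Icc_right ht.2
  have hexp : ∀ s, HasDerivAt (fun s => Real.exp (lam * s)) (lam * Real.exp (lam * s)) s := fun s => by
    have := ((hasDerivAt_id s).const_mul lam).exp
    simpa [mul_comm] using this
  have hmain := image_norm_le_of_norm_deriv_right_le_deriv_boundary
    (f := fun s => Real.exp (lam * s) * z s) (f' := fun s => Real.exp (lam * s) * φ s) (a := 0) (b := t)
    (B := fun s => |z 0| + Φ / lam * (Real.exp (lam * s) - 1))
    (B' := fun s => Φ / lam * (lam * Real.exp (lam * s))) ?_ ?_ ?_ ?_ ?_ (right_mem_Icc.2 ht.1)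
  · simp only [norm_mul, Real.norm_eq_abs, Real.abs_exp] at hmain
    have h1 : 0 < Real.exp (lam * t) := Real.exp_pos _
    have h2 : 1 ≤ Real.exp (lam * t) := Real.one_le_exp (mul_nonneg hlam.le ht.1)
    have h3 : Real.exp (lam * t) * (lam * |z t|) ≤ Real.exp (lam * t) * (lam * |z 0| + Φ) := by
      calc Real.exp (lam * t) * (lam * |z t|) = lam * (Real.exp (lam * t) * |z t|) := by ring
        _ ≤ lam * (|z 0| + Φ / lam * (Real.exp (lam * t) - 1)) := by gcongr
        _ = lam * |z 0| + Φ * (Real.exp (lam * t) - 1) := by field_simp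
        _ ≤ Real.exp (lam * t) * (lam * |z 0| + Φ) := by
          have : 0 ≤ lam * |z 0| := by positivity
          nlinarith
    exact le_of_mul_le_mul_left h3 h1
  · exact ContinuousOn.mul (by fun_prop) fun s hs => ((hz s (hsub hs)).mono hsub).continuousWithinAt
  · intro s hs
    have h1 : HasDerivWithinAt z (-lam * z s + φ s) (Ici s) s :=
      (hz s (hsub (Ico_subset_Icc_self hs))).mono_of_mem_nhdsWithin
        (mem_of_superset (Icc_mem_nhdsGE (hs.2.trans_le ht.2)) (Icc_subset_Icc_left hs.1))
    exact ((hexp s).hasDerivWithinAt.mul h1).congr_deriv (by ring)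
  · simp
  · intro s
    exact (((hexp s).sub_const 1).const_mul _).const_add _
  · intro s hs
    rw [norm_mul, Real.norm_eq_abs, Real.norm_eq_abs, Real.abs_exp]
    have h1 : Φ / lam * (lam * Real.exp (lam * s)) = Real.exp (lam * s) * Φ := by field_simp
    rw [h1]
    exact mul_le_mul_of_nonneg_left (hφ s (Ico_subset_Icc_self hs)) (Real.exp_nonneg _)

namespace SmoothKernel

variable {T β : ℝ} {M : ℝ → ℝ → ℝ} {m : ℕ}

theorem exists_gradedBound_zero (hT : 0 < T) (hβ : β < 1) (hM : WeakKernel T β M) {c : ℝ}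
    (hc : 0 ≤ c) :
    ∃ C, 1 ≤ C ∧ ∀ (lam Λ B : ℝ) (z y g : ℝ → ℝ), 0 < lam → lam ≤ Λ → Λ ≤ c * lam → 0 ≤ B →
      |z 0| ≤ B → ContinuousOn y (Icc 0 T) →
      (∀ t ∈ Icc 0 T, HasDerivWithinAt z (y t) (Icc 0 T) t) →
      (∀ t ∈ Icc 0 T, |g t| ≤ B * Λ) →
      (∀ t ∈ Icc 0 T, y t + volterra M y t = -lam * z t + g t) →
      GradedBound T Λ 1 (C * B) z := by
  obtain ⟨σ, hσ, hw⟩ := hM.exists_weight hβ (η := 1 / 4) (by norm_num)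
  have hw := hw σ le_rfl
  set K := Real.exp (σ * T) with hK
  have hK1 : 1 ≤ K := Real.one_le_exp (by positivity)
  refine ⟨6 * K + 1 + 2 * c * (1 + K), by nlinarith, ?_⟩
  intro lam Λ B z y g hlam hlamΛ hΛc hB hz0 hy hz hg heq
  have hΛ : 0 < Λ := hlam.trans_le hlamΛ
  obtain ⟨A, hA, hbd, t₀, ht₀, hatt⟩ := exists_weighted_sup hT hy σ
  have hF := hw y A hA hbd
  have hz' : ∀ s ∈ Icc 0 T, HasDerivWithinAt z (-lam * z s + (g s - volterra M y s)) (Icc 0 T) s :=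
    fun s hs => (hz s hs).congr_deriv (by linarith [heq s hs])
  have hdamp : ∀ t ∈ Icc 0 T, lam * |z t| ≤ B * Λ + (B * Λ + 1 / 4 * A * Real.exp (σ * t)) := by
    intro t ht
    have h1 := mul_abs_le_of_hasDerivWithinAt (Φ := B * Λ + 1 / 4 * A * Real.exp (σ * t)) hlam ht hz' ?_
    · have h2 : lam * |z 0| ≤ B * Λ := by
        rw [mul_comm B]
        exact mul_le_mul hlamΛ hz0 (abs_nonneg _) hΛ.le
      linarith
    · intro s hs
      have hsT : s ∈ Icc 0 T := ⟨hs.1, hs.2.trans ht.2⟩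
      refine (abs_sub _ _).trans (add_le_add (hg s hsT) ((hF s hsT).trans ?_))
      have := mul_le_mul_of_nonneg_left hs.2 hσ
      gcongr
  have hexp1 : ∀ t ∈ Icc 0 T, 1 ≤ Real.exp (σ * t) := fun t ht =>
    Real.one_le_exp (mul_nonneg hσ ht.1)
  have hexpK : ∀ t ∈ Icc 0 T, Real.exp (σ * t) ≤ K := fun t ht => by
    have := mul_le_mul_of_nonneg_left ht.2 hσ
    exact Real.exp_le_exp.2 this
  have hBΛ : 0 ≤ B * Λ := by positivity
  have hA6 : A ≤ 6 * (B * Λ) := by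
    have h1 : |y t₀| ≤ 3 * (B * Λ) + 1 / 2 * A * Real.exp (σ * t₀) := by
      have h2 : y t₀ = -(lam * z t₀) + (g t₀ - volterra M y t₀) := by linarith [heq t₀ ht₀]
      have h3 := abs_add_le (-(lam * z t₀)) (g t₀ - volterra M y t₀)
      rw [← h2, abs_neg, abs_mul, abs_of_pos hlam] at h3
      have h4 := abs_sub (g t₀) (volterra M y t₀)
      linarith [hdamp t₀ ht₀, hF t₀ ht₀, hg t₀ ht₀]
    rw [hatt] at h1
    have h5 := hexp1 t₀ ht₀
    nlinarith
  have hAK : ∀ t ∈ Icc 0 T, A * Real.exp (σ * t) ≤ 6 * K * (B * Λ) := fun t ht => by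
    calc A * Real.exp (σ * t) ≤ 6 * (B * Λ) * K :=
          mul_le_mul hA6 (hexpK t ht) (Real.exp_nonneg _) (by positivity)
      _ = _ := by ring
  refine ⟨fun t ht => ?_, y, hz, hy, fun t ht => (hbd t ht).trans ((hAK t ht).trans ?_)⟩
  · have h1 : lam * |z t| ≤ lam * (2 * c * (1 + K) * B) := by
      have h2 : lam * |z t| ≤ (2 + 3 / 2 * K) * (B * Λ) := by linarith [hdamp t ht, hAK t ht]
      have h3 : B * Λ ≤ B * (c * lam) := mul_le_mul_of_nonneg_left hΛc hB
      calc lam * |z t| ≤ (2 + 3 / 2 * K) * (B * Λ) := h2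
        _ ≤ (2 + 2 * K) * (B * (c * lam)) := by gcongr; linarith
        _ = _ := by ring
    have h4 := le_of_mul_le_mul_left h1 hlam
    refine h4.trans (mul_le_mul_of_nonneg_right ?_ hB)
    have : 0 ≤ c * K := by positivity
    nlinarith
  · have h1 : 0 ≤ (1 + 2 * c * (1 + K)) * (B * Λ) := by positivity
    nlinarith

end SmoothKernel

namespace SmoothKernel

variable {T β : ℝ} {M N : ℝ → ℝ → ℝ} {m : ℕ}

/-- Solutions of `z' + volterra M z' = -lam z + g` obey a graded bound whose constant does not
depend on the eigenvalue `lam`. -/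
theorem exists_gradedBound_solution (hT : 0 < T) (hβ : β < 1) (hM : SmoothKernel T β m M) {c : ℝ}
    (hc : 0 ≤ c) :
    ∃ C, 1 ≤ C ∧ ∀ (lam Λ B : ℝ) (z y g : ℝ → ℝ), 0 < lam → 1 ≤ Λ → lam ≤ Λ → Λ ≤ c * lam →
      0 ≤ B → |z 0| ≤ B → ContinuousOn y (Icc 0 T) →
      (∀ t ∈ Icc 0 T, HasDerivWithinAt z (y t) (Icc 0 T) t) →
      GradedBound T Λ m (B * Λ) g →
      (∀ t ∈ Icc 0 T, y t + volterra M y t = -lam * z t + g t) →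
      GradedBound T Λ (m + 1) (C * B) z := by
  have h0T : (0:ℝ) ∈ Icc 0 T := left_mem_Icc.2 hT.le
  induction m with
  | zero =>
    obtain ⟨C, hC, h⟩ := exists_gradedBound_zero hT hβ hM hc
    exact ⟨C, hC, fun lam Λ B z y g hlam _ h1 h2 hB hz0 hy hz hg heq =>
      h lam Λ B z y g hlam h1 h2 hB hz0 hy hz hg.abs_le heq⟩
  | succ m ih =>
    obtain ⟨C₁, hC₁, ih⟩ := ih hM.of_succ
    obtain ⟨hMw, ⟨d, hd, hdM⟩, N, hMN, hN⟩ := hM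
    obtain ⟨C₂, hC₂, hv⟩ := hN.exists_gradedBound_volterra hT hβ
    obtain ⟨D, hD, hdb⟩ := exists_gradedBound_of_contDiffOn hT hd
    set C' := 1 + C₁ * (1 + D + C₂) with hC'
    have hC'1 : C₁ ≤ C' := by
      have : 0 ≤ C₁ * (D + C₂) := by positivity
      nlinarith
    refine ⟨C₁ * C', by nlinarith, fun lam Λ B z y g hlam hΛ h1 h2 hB hz0 hy hz hg heq => ?_⟩
    have hΛ0 : 0 ≤ Λ := by linarith
    have hz1 := ih lam Λ B z y g hlam hΛ h1 h2 hB hz0 hy hz hg.of_succ heq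
    have hym : GradedBound T Λ m (C₁ * B * Λ) y := by
      obtain ⟨_, y₂, hy₂, hb⟩ := hz1
      exact hb.congr fun t ht =>
        (uniqueDiffOn_Icc hT t ht).eq_deriv _ (hz t ht) (hy₂ t ht)
    obtain ⟨_, g', hg', hgb⟩ := hg
    obtain ⟨y', hy', hyd, hyeq⟩ := WeakKernel.exists_hasDerivWithinAt_of_volterra_eq hT hβ hMw
      hN.weakKernel hd.continuousOn hdM hMN (G := fun t => -lam * z t + g t)
      (G' := fun t => -lam * y t + g' t) hy (fun t ht => ((hz t ht).const_mul _).add (hg' t ht))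
      ((continuousOn_const.mul hy).add hgb.continuousOn) heq
    have hy0 : |y 0| ≤ C₁ * B * Λ := hym.abs_le 0 h0T
    have hBΛ : 0 ≤ B * Λ := by positivity
    have hC₁0 : 0 ≤ C₁ := by linarith
    have hB'Λ : 0 ≤ C₁ * B * Λ := by positivity
    have hg₁ : GradedBound T Λ m (C' * (B * Λ) * Λ)
        (fun t => g' t - y 0 * d t - volterra N y t) := by
      refine ((hgb.sub ((hdb Λ hΛ).const_mul (y 0))).sub
        (hv Λ (C₁ * B * Λ) y hΛ hB'Λ hym)).mono hΛ0 ?_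
      have e1 : |y 0| * D ≤ C₁ * B * Λ * D := mul_le_mul_of_nonneg_right hy0 hD
      have e2 : C₁ * B * Λ * D ≤ C₁ * B * Λ * D * Λ := le_mul_of_one_le_right (by positivity) hΛ
      have e3 : C₂ * (C₁ * B * Λ) ≤ C₂ * (C₁ * B * Λ) * Λ :=
        le_mul_of_one_le_right (by positivity) hΛ
      have e4 : 0 ≤ C₁ * (B * Λ) * Λ := by positivity
      calc _ ≤ B * Λ * Λ + C₁ * B * Λ * D * Λ + C₂ * (C₁ * B * Λ) * Λ := by linarith
        _ ≤ C' * (B * Λ) * Λ := by rw [hC']; linarith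
    have hyb := ih lam Λ (C' * (B * Λ)) y y' _ hlam hΛ h1 h2 (by positivity)
      (hy0.trans (by rw [mul_assoc]; exact mul_le_mul_of_nonneg_right hC'1 hBΛ)) hy' hyd hg₁
      (fun t ht => by rw [hyeq t ht]; ring)
    refine ⟨fun t ht => (hz1.abs_le t ht).trans ?_, y, hz, ?_⟩
    · refine mul_le_mul_of_nonneg_right ?_ hB
      nlinarith
    · convert hyb using 1
      ring

theorem add (hM : SmoothKernel T β m M) (hN : SmoothKernel T β m N) :
    SmoothKernel T β m (fun t r => M t r + N t r) := by
  have weak : ∀ {M N : ℝ → ℝ → ℝ}, WeakKernel T β M → WeakKernel T β N →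
      WeakKernel T β (fun t r => M t r + N t r) := by
    intro M N hM hN
    obtain ⟨C, hC, hb⟩ := hM.bound
    obtain ⟨D, hD, hb'⟩ := hN.bound
    refine ⟨hM.continuousOn.add hN.continuousOn, C + D, by positivity, fun t ht r hr => ?_⟩
    rw [add_mul]
    exact (abs_add_le _ _).trans (add_le_add (hb t ht r hr) (hb' t ht r hr))
  induction m generalizing M N with
  | zero => exact weak hM hN
  | succ m ih =>
    obtain ⟨hM, ⟨d, hd, hdM⟩, M', hMM', hM'⟩ := hM
    obtain ⟨hN, ⟨e, he, heN⟩, N', hNN', hN'⟩ := hN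
    exact ⟨weak hM hN, ⟨fun t => d t + e t, hd.add he, fun t ht => congrArg₂ _ (hdM t ht) (heN t ht)⟩, _,
      fun r hr t ht => (hMM' r hr t ht).add (hNN' r hr t ht), ih hM' hN'⟩

end SmoothKernel

theorem contDiff_inv_gamma : ContDiff ℝ ⊤ (fun s : ℝ => (Real.Gamma s)⁻¹) := by
  have h := (Complex.differentiable_one_div_Gamma.contDiff (n := ⊤)).real_of_complex
  have e : (fun s : ℝ => (Real.Gamma s)⁻¹) = fun s : ℝ => ((Complex.Gamma s)⁻¹).re := by
    ext s
    rw [Complex.Gamma_ofReal, ← Complex.ofReal_inv, Complex.ofReal_re]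
  rw [e]
  exact h

/-- Passage from the Caputo derivative to a Volterra operator. -/
theorem mul_caputo_eq_volterra (k α v : ℝ → ℝ) (t : ℝ) :
    k t * caputo α v t =
      volterra (fun t r => k t * (Real.Gamma (1 - α t))⁻¹ * r ^ (-(α t))) v t := by
  have h := intervalIntegral.integral_comp_sub_left (a := 0) (b := t)
    (fun s => v s * (t - s) ^ (-(α t))) t
  simp only [sub_self, sub_zero, sub_sub_cancel] at h
  rw [caputo, volterra, ← h, one_div, ← mul_assoc, ← intervalIntegral.integral_const_mul]
  congr 1
  ext r
  ring

section LogRpowKernel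

variable {T β αstar : ℝ} {α a : ℝ → ℝ}

theorem weakKernel_mul_log_pow_mul_rpow (hT : 0 < T) (hα : ContinuousOn α (Icc 0 T))
    (hbd : ∀ t ∈ Icc 0 T, 0 ≤ α t ∧ α t ≤ αstar) (hβ : αstar < β) (ha : ContinuousOn a (Icc 0 T))
    (j : ℕ) : WeakKernel T β (fun t r => a t * Real.log r ^ j * r ^ (-(α t))) := by
  obtain ⟨A, hA, hab⟩ := exists_abs_le_of_continuousOn ha
  obtain ⟨C, hC, hlog⟩ := (SymbolClass.log_pow (q := 0) hT j).bound (β - αstar) (by linarith)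
  refine ⟨?_, A * C * (1 + T) ^ αstar, by positivity, fun t ht r hr => ?_⟩
  · have h1 : ContinuousOn (fun p : ℝ × ℝ => p.1) (Icc 0 T ×ˢ Ioc 0 T) := by fun_prop
    have h2 : ContinuousOn (fun p : ℝ × ℝ => p.2) (Icc 0 T ×ˢ Ioc 0 T) := by fun_prop
    have hmaps : MapsTo (fun p : ℝ × ℝ => p.1) (Icc 0 T ×ˢ Ioc 0 T) (Icc 0 T) := fun p hp => hp.1
    have hne : ∀ p ∈ Icc 0 T ×ˢ Ioc 0 T, (p : ℝ × ℝ).2 ≠ 0 := fun p hp => hp.2.1.ne'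
    exact ((ha.comp h1 hmaps).mul ((h2.log hne).pow j)).mul
      (h2.rpow (hα.comp h1 hmaps).neg fun p hp => Or.inl (hne p hp))
  · have h1 : r ^ (-(α t)) = r ^ (αstar - α t) * r ^ (-αstar) := by
      rw [← Real.rpow_add hr.1]; congr 1; ring
    have h2 : r ^ (αstar - α t) ≤ (1 + T) ^ αstar := by
      refine (Real.rpow_le_rpow hr.1.le (by linarith [hr.2] : r ≤ 1 + T)
        (by linarith [(hbd t ht).2])).trans ?_
      exact Real.rpow_le_rpow_of_exponent_le (by linarith) (by linarith [(hbd t ht).1])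
    have h3 : r ^ (-β) = r ^ (0 - (β - αstar)) * r ^ (-αstar) := by
      rw [← Real.rpow_add hr.1]; congr 1; ring
    have h4 := Real.rpow_nonneg hr.1.le (-αstar)
    have h5 := Real.rpow_nonneg hr.1.le (αstar - α t)
    have h6 := Real.rpow_nonneg hr.1.le (0 - (β - αstar))
    rw [abs_mul, abs_mul, abs_of_nonneg (Real.rpow_nonneg hr.1.le _), h1, h3]
    calc |a t| * |Real.log r ^ j| * (r ^ (αstar - α t) * r ^ (-αstar))
        ≤ A * (C * r ^ (0 - (β - αstar))) * ((1 + T) ^ αstar * r ^ (-αstar)) := by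
          have := hab t ht
          have := hlog r hr
          gcongr
      _ = _ := by ring

/-- The trace `t ^ (-α t)` extends smoothly to `t = 0`. -/
theorem contDiffOn_exp_neg_mul_log (hT : 0 < T) {p m : ℕ} (hαS : SymbolClass T p p α)
    (hm : m + 1 ≤ p) : ContDiffOn ℝ m (fun t => Real.exp (-(α t * Real.log t))) (Icc 0 T) := by
  have h1 : SymbolClass T m (p + 0) (fun t => α t * Real.log t) :=
    (hαS.of_le (by omega)).mul (SymbolClass.log hT)
  have h2 : (m : ℝ) + 1 ≤ p + 0 := by
    rw [add_zero]
    exact_mod_cast hm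
  exact (h1.contDiffOn_of_eqOn hT h2 (fun _ _ => rfl) (by simp)).neg.exp

theorem smoothKernel_mul_log_pow_mul_rpow (hT : 0 < T) {p : ℕ} (hα : ContDiffOn ℝ p α (Icc 0 T))
    (hαS : SymbolClass T p p α) (hbd : ∀ t ∈ Icc 0 T, 0 ≤ α t ∧ α t ≤ αstar) (hβ : αstar < β)
    {m : ℕ} (hm : m ≤ p) (j : ℕ) (ha : ContDiffOn ℝ m a (Icc 0 T))
    (haS : j ≠ 0 → SymbolClass T m m a) :
    SmoothKernel T β m (fun t r => a t * Real.log r ^ j * r ^ (-(α t))) := by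
  have weak : ∀ {m : ℕ} {a : ℝ → ℝ}, ContDiffOn ℝ m a (Icc 0 T) → ∀ j : ℕ,
      WeakKernel T β (fun t r => a t * Real.log r ^ j * r ^ (-(α t))) := fun ha j =>
    weakKernel_mul_log_pow_mul_rpow hT hα.continuousOn hbd hβ ha.continuousOn j
  induction m generalizing a j with
  | zero => exact weak ha j
  | succ m ih =>
    obtain ⟨had, ha'⟩ := exists_hasDerivWithinAt_of_contDiffOn_succ hT ha
    obtain ⟨hαd, hα'⟩ := exists_hasDerivWithinAt_of_contDiffOn_succ hT
      (hα.of_le (m := ((m + 1 : ℕ) : WithTop ℕ∞)) (by exact_mod_cast hm))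
    have ham : ContDiffOn ℝ m a (Icc 0 T) := ha.of_le (by exact_mod_cast Nat.le_succ m)
    have hpm : (m : ℝ) + 1 ≤ p := by exact_mod_cast hm
    have hαS' : SymbolClass T m (p - 1) (derivWithin α (Icc 0 T)) :=
      (hαS.of_le hm).derivWithin_icc hT
    refine ⟨weak ha j, ⟨fun t => a t * Real.log t ^ j * Real.exp (-(α t * Real.log t)), ?_, ?_⟩, _,
      ?_, (ih (by omega) j ha' fun hj => ?_).add
        (ih (a := fun t => -a t * derivWithin α (Icc 0 T) t) (by omega) (j + 1) (ham.neg.mul hα')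
          fun _ => ?_)⟩
    · refine ContDiffOn.mul ?_ (contDiffOn_exp_neg_mul_log hT hαS hm)
      rcases eq_or_ne j 0 with rfl | hj
      · simpa using ham
      · have h1 : SymbolClass T m ((m + 1 : ℕ) + 0) (fun t => a t * Real.log t ^ j) :=
          ((haS hj).of_le (by omega)).mul (SymbolClass.log_pow hT j)
        exact h1.contDiffOn_of_eqOn hT (by push_cast; linarith) (fun _ _ => rfl) (by simp [hj])
    · intro t ht
      simp only [Real.rpow_def_of_pos ht.1]
      congr 2
      ring
    · intro r hr t ht
      exact (((had t ht).mul_const (Real.log r ^ j)).mul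
        ((hαd t ht).neg.const_rpow hr.1)).congr_deriv (by rw [Pi.neg_apply]; ring)
    · have := (haS hj).derivWithin_icc hT
      simpa using this
    · have h1 := (SymbolClass.of_contDiffOn hT ham.neg).mul hαS'
      exact h1.mono (by linarith)

end LogRpowKernel

theorem WithTop.natCast_succ_sub_one (p : ℕ) :
    (((p + 1 : ℕ) : WithTop ℕ∞) - 1) = (p : WithTop ℕ∞) := by
  have h : (((p + 1 : ℕ) : ℕ∞) - 1) = (p : ℕ∞) := by
    push_cast
    exact (ENat.addLECancellable_of_ne_top (by simp)).add_tsub_cancel_right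
  calc (((p + 1 : ℕ) : WithTop ℕ∞) - 1) = (((((p + 1 : ℕ) : ℕ∞) - 1 : ℕ∞)) : WithTop ℕ∞) := rfl
    _ = _ := by rw [h]; rfl

section Mode

variable {T αstar : ℝ} {α k : ℝ → ℝ} {p : ℕ}

/-- Graded bounds for a single mode, uniformly in the eigenvalue. -/
theorem exists_gradedBound_mode (hT : 0 < T) (hαstar1 : αstar < 1)
    (hbd : ∀ t ∈ Icc 0 T, 0 ≤ α t ∧ α t ≤ αstar)
    (hα : ContDiffOn ℝ p α (Icc 0 T)) (hk : ContDiffOn ℝ p k (Icc 0 T))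
    (hαS : SymbolClass T p p α) {c : ℝ} (hc : 1 ≤ c) :
    ∃ C, 1 ≤ C ∧ ∀ (lam : ℝ) (u : ℝ → ℝ), 0 < lam → 1 ≤ c * lam →
      ContDiffOn ℝ 1 u (Icc 0 T) →
      (∀ t ∈ Ioc 0 T, derivWithin u (Icc 0 T) t
        + k t * caputo α (derivWithin u (Icc 0 T)) t = -lam * u t) →
      GradedBound T (c * lam) (p + 1) (C * |u 0|) u := by
  have ha : ContDiffOn ℝ p (fun t => k t * (Real.Gamma (1 - α t))⁻¹) (Icc 0 T) :=
    hk.mul ((contDiff_inv_gamma.of_le le_top).comp_contDiffOn (contDiffOn_const.sub hα))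
  have hβ : (1 + αstar) / 2 < 1 := by linarith
  have hM : SmoothKernel T ((1 + αstar) / 2) p
      (fun t r => k t * (Real.Gamma (1 - α t))⁻¹ * r ^ (-(α t))) := by
    simpa using smoothKernel_mul_log_pow_mul_rpow hT hα hαS hbd (by linarith) le_rfl 0 ha
      (fun h => absurd rfl h)
  obtain ⟨C, hC, h⟩ := hM.exists_gradedBound_solution hT hβ (c := c) (by linarith)
  refine ⟨C, hC, fun lam u hlam hclam hu heq => ?_⟩
  obtain ⟨hud, hu'⟩ := exists_hasDerivWithinAt_of_contDiffOn_succ hT (m := 0) (by simpa using hu)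
  refine h lam (c * lam) |u 0| u _ (fun _ => 0) hlam hclam (by nlinarith) le_rfl (abs_nonneg _)
    le_rfl hu'.continuousOn hud ?_ ?_
  · obtain ⟨D, hD, h0⟩ := exists_gradedBound_of_contDiffOn (m := p) hT
      (contDiffOn_const (c := (0:ℝ)))
    refine (((h0 _ hclam).const_mul 0).mono (by linarith) ?_).congr fun t _ => by simp
    rw [abs_zero, zero_mul]
    positivity
  · have hF := hM.weakKernel.continuousOn_volterra hβ hu'.continuousOn
    have hEq : EqOn (fun t => derivWithin u (Icc 0 T) t + volterra
        (fun t r => k t * (Real.Gamma (1 - α t))⁻¹ * r ^ (-(α t))) (derivWithin u (Icc 0 T)) t)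
        (fun t => -lam * u t + 0) (Icc 0 T) := by
      have h1 : EqOn (fun t => derivWithin u (Icc 0 T) t + volterra
        (fun t r => k t * (Real.Gamma (1 - α t))⁻¹ * r ^ (-(α t))) (derivWithin u (Icc 0 T)) t)
        (fun t => -lam * u t + 0) (Ioc 0 T) := fun t ht => by
        simp only [← mul_caputo_eq_volterra, heq t ht, add_zero]
      refine h1.of_subset_closure (hu'.continuousOn.add hF)
        ((continuousOn_const.mul hu.continuousOn).add continuousOn_const) Ioc_subset_Icc_self ?_
      rw [closure_Ioc hT.ne]
    exact hEq

end Mode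

/-- Spectral form of the full-regularity case of Theorem 3.2: under Assumption A, if moreover
`α, k ∈ C^{n-1}[0,T]`, `α^{(l)}(0) = 0` for `0 ≤ l ≤ n-2`, `lim_{t→0⁺} α^{(n-2)}(t) ln t` exists,
and the data `(u₀ᵢ)` is in `H^{γ+2n}`, then each mode `uᵢ` is `C^n([0,T])` and
`‖u‖_{C^n([0,T];H^γ)} ≤ Q ‖u₀‖_{H^{γ+2n}}` with `Q` independent of the data.
Modes are indexed so that `lam i` is `λ_{i+1} = K (i+1)² π²/L²`. -/
theorem full_regularity_spectral
    (n : ℕ) (hn : 2 ≤ n)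
    (T K L αstar γ : ℝ) (α k : ℝ → ℝ)
    (hT : 0 < T) (hK : 0 < K) (hL : 0 < L)
    (hαcont : ContinuousOn α (Icc 0 T)) (hkcont : ContinuousOn k (Icc 0 T))
    (hαstar0 : 0 < αstar) (hαstar1 : αstar < 1)
    (hαbdd : ∀ t ∈ Icc 0 T, 0 ≤ α t ∧ α t ≤ αstar)
    (hlim : ∃ ℓ : ℝ, Tendsto (fun t => (α t - α 0) * Real.log t)
      (nhdsWithin 0 (Ioi 0)) (nhds ℓ))
    (hαsmooth : ContDiffOn ℝ (n - 1) α (Icc 0 T))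
    (hksmooth : ContDiffOn ℝ (n - 1) k (Icc 0 T))
    (hαvanish : ∀ l ≤ n - 2, iteratedDerivWithin l α (Icc 0 T) 0 = 0)
    (hlim2 : ∃ ℓ : ℝ, Tendsto (fun t => iteratedDerivWithin (n - 2) α (Icc 0 T) t * Real.log t)
      (nhdsWithin 0 (Ioi 0)) (nhds ℓ))
    (hγ : 1/2 < γ)
    (lam : ℕ → ℝ) (hlam : ∀ i, lam i = K * ((i : ℝ) + 1)^2 * π^2 / L^2) :
    ∃ Q : ℝ, 0 < Q ∧
      ∀ (u₀ : ℕ → ℝ) (u : ℕ → ℝ → ℝ),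
        Summable (fun i => lam i ^ (γ + 2 * (n : ℝ)) * (u₀ i)^2) →
        (∀ i, ContDiffOn ℝ 1 (u i) (Icc 0 T) ∧ u i 0 = u₀ i ∧
          ∀ t ∈ Ioc 0 T,
            derivWithin (u i) (Icc 0 T) t
              + k t * caputo α (derivWithin (u i) (Icc 0 T)) t = -(lam i) * u i t) →
        (∀ i, ContDiffOn ℝ n (u i) (Icc 0 T)) ∧
        ∀ l ≤ n, ∀ t ∈ Icc 0 T,
          Summable (fun i => lam i ^ γ * (iteratedDerivWithin l (u i) (Icc 0 T) t)^2) ∧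
          (∑' i, lam i ^ γ * (iteratedDerivWithin l (u i) (Icc 0 T) t)^2)
            ≤ Q^2 * ∑' i, lam i ^ (γ + 2 * (n : ℝ)) * (u₀ i)^2 := by
  obtain ⟨p, rfl⟩ : ∃ p, n = p + 1 := ⟨n - 1, by omega⟩
  rw [WithTop.natCast_succ_sub_one] at hαsmooth hksmooth
  have hlam0 : ∀ i, lam 0 ≤ lam i := fun i => by
    have h1 : (1:ℝ) ≤ ((i:ℝ) + 1) ^ 2 := by nlinarith [(Nat.cast_nonneg i : (0:ℝ) ≤ i)]
    rw [hlam, hlam]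
    have h2 : ((0:ℕ):ℝ) + 1 = 1 := by norm_num
    rw [h2, one_pow]
    gcongr
  have hlampos : ∀ i, 0 < lam i := fun i => by
    rw [hlam]
    positivity
  set c := max 1 (1 / lam 0) with hc
  have hc1 : 1 ≤ c := le_max_left _ _
  have hclam : ∀ i, 1 ≤ c * lam i := fun i => by
    have h1 : 1 / lam 0 ≤ c := le_max_right _ _
    rw [div_le_iff₀ (hlampos 0)] at h1
    exact h1.trans (mul_le_mul_of_nonneg_left (hlam0 i) (by linarith))
  have hαS : SymbolClass T p p α := symbolClass_of_iteratedDerivWithin_eq_zero hT hαsmooth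
    fun l hl => hαvanish l (by omega)
  obtain ⟨C, hC, hmode⟩ := exists_gradedBound_mode hT hαstar1 hαbdd hαsmooth hksmooth hαS hc1
  refine ⟨C * c ^ (p + 1), by positivity, fun u₀ u hsum hu => ?_⟩
  have hreg : ∀ i, ContDiffOn ℝ ((p + 1 : ℕ)) (u i) (Icc 0 T) ∧ ∀ l ≤ p + 1, ∀ t ∈ Icc 0 T,
      |iteratedDerivWithin l (u i) (Icc 0 T) t| ≤ C * |u₀ i| * (c * lam i) ^ l := fun i => by
    obtain ⟨h1, h2, h3⟩ := hu i
    rw [← h2]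
    exact (hmode (lam i) (u i) (hlampos i) (hclam i) h1 h3).contDiffOn_and_abs_iteratedDerivWithin_le
      hT
  refine ⟨fun i => (hreg i).1, fun l hl t ht => ?_⟩
  have hterm : ∀ i, lam i ^ γ * (iteratedDerivWithin l (u i) (Icc 0 T) t) ^ 2 ≤
      (C * c ^ (p + 1)) ^ 2 * (lam i ^ (γ + 2 * ((p + 1 : ℕ) : ℝ)) * (u₀ i) ^ 2) := fun i => by
    have h1 : |iteratedDerivWithin l (u i) (Icc 0 T) t| ≤ C * |u₀ i| * (c * lam i) ^ (p + 1) :=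
      ((hreg i).2 l hl t ht).trans (mul_le_mul_of_nonneg_left
        (pow_le_pow_right₀ (hclam i) hl) (by positivity))
    have h2 : lam i ^ (γ + 2 * ((p + 1 : ℕ) : ℝ)) = lam i ^ γ * (lam i ^ (p + 1)) ^ 2 := by
      rw [Real.rpow_add (hlampos i), ← pow_mul, mul_comm (p + 1) 2, ← Real.rpow_natCast]
      push_cast
      rfl
    have h3 := Real.rpow_nonneg (hlampos i).le γ
    calc lam i ^ γ * (iteratedDerivWithin l (u i) (Icc 0 T) t) ^ 2
        = lam i ^ γ * |iteratedDerivWithin l (u i) (Icc 0 T) t| ^ 2 := by rw [sq_abs]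
      _ ≤ lam i ^ γ * (C * |u₀ i| * (c * lam i) ^ (p + 1)) ^ 2 := by gcongr
      _ = (C * c ^ (p + 1)) ^ 2 * (lam i ^ γ * (lam i ^ (p + 1)) ^ 2 * |u₀ i| ^ 2) := by ring
      _ = _ := by rw [h2, sq_abs]
  have hmaj := hsum.mul_left ((C * c ^ (p + 1)) ^ 2)
  have hs : Summable (fun i => lam i ^ γ * (iteratedDerivWithin l (u i) (Icc 0 T) t) ^ 2) :=
    hmaj.of_nonneg_of_le
      (fun i => mul_nonneg (Real.rpow_nonneg (hlampos i).le γ) (sq_nonneg _)) hterm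
  refine ⟨hs, ?_⟩
  rw [← tsum_mul_left]
  exact hs.tsum_le_tsum hterm hmaj
end
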